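/- arXiv:quant-ph/0003136 — 3 statements merged into one kernel-verified Lean document; each statement's English description precedes it below -/
import Mathlib

section
/- Let λ be a partition of n with first row of length n − ℓ, ℓ < n/2, and λ₁ the partition of n−1 obtained by removing the last cell of the first row. Then the ratio dim ρ_{λ₁}/dim ρ_λ equals (1/n)·(∏_{x∈λ} h(x))/(∏_{x∈λ₁} h(x)), where h(x) denotes hook lengths, and this ratio is at least ∏_{i=1}^{n−2ℓ−1} (i+1)/i · (1/n) = (n−2ℓ)/n. -/
/-- The number of standard Young tableaux of shape `μ` (the dimension of the
    irreducible representation `ρ_μ` of the symmetric group). -/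
noncomputable def numSYT (μ : YoungDiagram) : ℕ :=
  Nat.card {f : μ.cells → Fin μ.card //
    Function.Bijective f ∧
    ∀ c₁ c₂ : μ.cells, (c₁ : ℕ × ℕ).1 ≤ (c₂ : ℕ × ℕ).1 →
      (c₁ : ℕ × ℕ).2 ≤ (c₂ : ℕ × ℕ).2 → c₁ ≠ c₂ → f c₁ < f c₂}

/-- The hook length of the cell `c = (i,j)` of `μ`:
    arm + leg + 1 = (rowLen i − j) + (colLen j − i) − 1. -/
def hookLen (μ : YoungDiagram) (c : ℕ × ℕ) : ℕ :=
  (μ.rowLen c.1 - c.2) + (μ.colLen c.2 - c.1) - 1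

open Finset in
theorem det_rowscale_sum {k : ℕ} (M : Matrix (Fin k) (Fin k) ℝ) (d : Fin k → ℝ) :
    ∑ i, (M.updateRow i (fun j => M i j * d j)).det = (∑ j, d j) * M.det := by
  have h1 : ∀ i, (M.updateRow i (fun j => M i j * d j)).det
      = ∑ j, M i j * d j * M.adjugate j i := by
    intro i
    rw [← Matrix.cramer_transpose_apply, Matrix.cramer_eq_adjugate_mulVec,
      ← Matrix.adjugate_transpose]
    simp only [Matrix.mulVec, dotProduct, Matrix.transpose_apply]
    exact Finset.sum_congr rfl fun j _ => by ring
  simp_rw [h1]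
  rw [Finset.sum_comm, Finset.sum_mul]
  refine Finset.sum_congr rfl fun j _ => ?_
  have h2 : (M.adjugate * M) j j = M.det := by
    rw [Matrix.adjugate_mul]; simp
  rw [← h2, Matrix.mul_apply, Finset.mul_sum]
  exact Finset.sum_congr rfl fun i _ => by ring

noncomputable def vdm {k : ℕ} (x : Fin k → ℝ) : ℝ :=
  ∏ i : Fin k, ∏ j ∈ Finset.Ioi i, (x i - x j)

theorem vdm_eq {k : ℕ} (x : Fin k → ℝ) :
    vdm x = (∏ i : Fin k, ∏ _j ∈ Finset.Ioi i, (-1 : ℝ)) *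
      (Matrix.of (fun i j : Fin k => (descPochhammer ℝ j).eval (x i))).det := by
  rw [← Matrix.det_eval_matrixOfPolynomials_eq_det_vandermonde x
    (fun i : Fin k => descPochhammer ℝ i) (fun i => descPochhammer_natDegree ℝ i)
    (fun i => monic_descPochhammer ℝ i), Matrix.det_vandermonde, ← Finset.prod_mul_distrib]
  unfold vdm
  refine Finset.prod_congr rfl fun i _ => ?_
  rw [← Finset.prod_mul_distrib]
  exact Finset.prod_congr rfl fun j _ => by ring

theorem descPoch_shift (x : ℝ) (j : ℕ) :
    x * (descPochhammer ℝ j).eval (x - 1) = (descPochhammer ℝ j).eval x * (x - j) := by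
  rw [← descPochhammer_succ_eval, descPochhammer_succ_left]
  simp

theorem vdm_sum {k : ℕ} (x : Fin k → ℝ) :
    ∑ i, x i * vdm (Function.update x i (x i - 1)) =
      (∑ i, x i - ∑ i : Fin k, ((i : ℕ) : ℝ)) * vdm x := by
  set M : Matrix (Fin k) (Fin k) ℝ :=
    Matrix.of (fun i j : Fin k => (descPochhammer ℝ j).eval (x i)) with hM
  set s := (∏ i : Fin k, ∏ _j ∈ Finset.Ioi i, (-1 : ℝ)) with hs
  have h1 : ∀ i, x i * vdm (Function.update x i (x i - 1)) =
      s * (x i * M.det - (M.updateRow i (fun j => M i j * ((j : ℕ) : ℝ))).det) := by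
    intro i
    rw [vdm_eq, ← hs]
    have e1 : (Matrix.of (fun a j : Fin k =>
        (descPochhammer ℝ j).eval (Function.update x i (x i - 1) a))) =
        M.updateRow i (fun j : Fin k => (descPochhammer ℝ j).eval (x i - 1)) := by
      ext a j
      by_cases h : a = i
      · subst h; simp
      · simp [h, hM]
    rw [e1]
    have e2 : x i * (M.updateRow i (fun j : Fin k => (descPochhammer ℝ j).eval (x i - 1))).det
        = (M.updateRow i (x i • M i + (-1 : ℝ) • (fun j => M i j * ((j : ℕ) : ℝ)))).det := by
      rw [← Matrix.det_updateRow_smul]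
      congr 2
      ext j
      simp only [Pi.smul_apply, smul_eq_mul, Pi.add_apply, descPoch_shift, hM, Matrix.of_apply]
      ring
    rw [Matrix.det_updateRow_add, Matrix.det_updateRow_smul, Matrix.det_updateRow_smul,
      Matrix.updateRow_eq_self] at e2
    linear_combination s * e2
  simp_rw [h1]
  rw [← Finset.mul_sum, Finset.sum_sub_distrib, det_rowscale_sum, vdm_eq, ← Finset.sum_mul]
  ring

/-- Fillings of a finite set of cells. -/
def TS (S : Finset (ℕ × ℕ)) : Set (ℕ × ℕ → ℕ) :=
  {f | (∀ c, c ∉ S → f c = 0) ∧ (∀ c ∈ S, f c < S.card) ∧ Set.InjOn f S ∧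
    ∀ c₁ ∈ S, ∀ c₂ ∈ S, c₁.1 ≤ c₂.1 → c₁.2 ≤ c₂.2 → c₁ ≠ c₂ → f c₁ < f c₂}

theorem TS_finite (S : Finset (ℕ × ℕ)) : Finite (TS S) := by
  refine Finite.of_injective (β := S → Fin S.card)
    (fun f c => ⟨f.1 c.1, f.2.2.1 c.1 c.2⟩) ?_
  rintro ⟨f, hf⟩ ⟨g, hg⟩ h
  ext c
  by_cases hc : c ∈ S
  · have := congrFun h ⟨c, hc⟩
    simpa using this
  · simp [hf.1 c hc, hg.1 c hc]

theorem numSYT_eq (μ : YoungDiagram) : numSYT μ = Nat.card (TS μ.cells) := by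
  unfold numSYT
  symm
  refine Nat.card_congr (Equiv.ofBijective (fun f : TS μ.cells =>
    ⟨fun c => ⟨f.1 c.1, f.2.2.1 c.1 c.2⟩, ?_, ?_⟩) ⟨?_, ?_⟩)
  · rw [Fintype.bijective_iff_injective_and_card]
    refine ⟨fun a b h => Subtype.ext (f.2.2.2.1 a.2 b.2 (by simpa using h)), by simp⟩
  · intro a b h1 h2 h3
    exact f.2.2.2.2 a.1 a.2 b.1 b.2 h1 h2 (fun h => h3 (Subtype.ext h))
  · rintro ⟨f, hf⟩ ⟨g, hg⟩ h
    ext c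
    by_cases hc : c ∈ μ.cells
    · have := congrFun (congrArg Subtype.val h) ⟨c, hc⟩
      simpa using this
    · simp only [hf.1 c hc, hg.1 c hc]
  · rintro ⟨f, hf1, hf2⟩
    refine ⟨⟨fun c => if h : c ∈ μ.cells then f ⟨c, h⟩ else 0, ?_, ?_, ?_, ?_⟩, ?_⟩
    · intro c hc
      exact dif_neg hc
    · intro c hc
      simp only [dif_pos hc]
      exact (f ⟨c, hc⟩).2
    · intro a ha b hb h
      have ha' : a ∈ μ.cells := ha
      have hb' : b ∈ μ.cells := hb
      simp only [dif_pos ha', dif_pos hb'] at h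
      exact congrArg Subtype.val (hf1.1 (Fin.ext h))
    · intro a ha b hb h1 h2 h3
      simp only [dif_pos ha, dif_pos hb]
      exact hf2 ⟨a, ha⟩ ⟨b, hb⟩ h1 h2 (fun h => h3 (congrArg Subtype.val h))
    · apply Subtype.ext
      funext c
      apply Fin.ext
      exact dif_pos c.2

/-- Maximal cells. -/
def maxc (S : Finset (ℕ × ℕ)) : Finset (ℕ × ℕ) :=
  S.filter (fun c => ∀ d ∈ S, c.1 ≤ d.1 → c.2 ≤ d.2 → d = c)

theorem TS_rec (S : Finset (ℕ × ℕ)) (hS : S.Nonempty) :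
    Nat.card (TS S) = ∑ c ∈ maxc S, Nat.card (TS (S.erase c)) := by
  classical
  have : ∀ c : maxc S, Finite (TS (S.erase c.1)) := fun c => TS_finite _
  rw [← Finset.sum_coe_sort, ← Nat.card_sigma]
  symm
  have hpos := hS.card_pos
  have hm : ∀ c ∈ maxc S, c ∈ S ∧ ∀ d ∈ S, c.1 ≤ d.1 → c.2 ≤ d.2 → d = c := by
    intro c hc
    exact Finset.mem_filter.1 hc
  refine Nat.card_congr (Equiv.ofBijective (fun p : (Σ c : maxc S, TS (S.erase c.1)) =>
    ⟨Function.update p.2.1 p.1.1 (S.card - 1), ?_, ?_, ?_, ?_⟩) ⟨?_, ?_⟩)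
  · obtain ⟨⟨c, hc⟩, ⟨g, hg⟩⟩ := p
    intro d hd
    have : d ≠ c := fun h => hd (h ▸ (hm c hc).1)
    simp only [Function.update_of_ne this]
    exact hg.1 d (fun h => hd (Finset.mem_of_mem_erase h))
  · obtain ⟨⟨c, hc⟩, ⟨g, hg⟩⟩ := p
    intro d hd
    by_cases h : d = c
    · subst h; simp; exact ⟨_, hd⟩
    · have := hg.2.1 d (Finset.mem_erase.2 ⟨h, hd⟩)
      rw [Finset.card_erase_of_mem (hm c hc).1] at this
      simp only [Function.update_of_ne h]
      omega
  · obtain ⟨⟨c, hc⟩, ⟨g, hg⟩⟩ := p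
    intro a ha b hb hab
    have key : ∀ d ∈ S, d ≠ c → g d < S.card - 1 := by
      intro d hd h
      have := hg.2.1 d (Finset.mem_erase.2 ⟨h, hd⟩)
      rwa [Finset.card_erase_of_mem (hm c hc).1] at this
    by_cases h1 : a = c <;> by_cases h2 : b = c
    · rw [h1, h2]
    · have := key b hb h2
      simp only [h1, Function.update_self, Function.update_of_ne h2] at hab
      omega
    · have := key a ha h1
      simp only [h2, Function.update_self, Function.update_of_ne h1] at hab
      omega
    · simp only [Function.update_of_ne h1, Function.update_of_ne h2] at hab
      exact hg.2.2.1 (Finset.mem_coe.2 (Finset.mem_erase.2 ⟨h1, ha⟩))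
        (Finset.mem_coe.2 (Finset.mem_erase.2 ⟨h2, hb⟩)) hab
  · obtain ⟨⟨c, hc⟩, ⟨g, hg⟩⟩ := p
    intro a ha b hb l1 l2 hne
    by_cases h1 : a = c
    · subst h1
      exact absurd ((hm a hc).2 b hb l1 l2).symm hne
    · by_cases h2 : b = c
      · have := hg.2.1 a (Finset.mem_erase.2 ⟨h1, ha⟩)
        rw [Finset.card_erase_of_mem (hm c hc).1] at this
        simpa only [h2, Function.update_self, Function.update_of_ne h1] using this
      · simp only [Function.update_of_ne h1, Function.update_of_ne h2]
        exact hg.2.2.2 a (Finset.mem_erase.2 ⟨h1, ha⟩) b (Finset.mem_erase.2 ⟨h2, hb⟩) l1 l2 hne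
  · rintro ⟨⟨c, hc⟩, ⟨g, hg⟩⟩ ⟨⟨c', hc'⟩, ⟨g', hg'⟩⟩ h
    have h0 : Function.update g c (S.card - 1) = Function.update g' c' (S.card - 1) :=
      congrArg Subtype.val h
    have hcc : c = c' := by
      by_contra hne
      have h1 := congrFun h0 c
      rw [Function.update_self, Function.update_of_ne hne] at h1
      have := hg'.2.1 c (Finset.mem_erase.2 ⟨hne, (hm c hc).1⟩)
      rw [Finset.card_erase_of_mem (hm c' hc').1] at this
      omega
    subst hcc
    have hgg : g = g' := by
      funext d
      by_cases hd : d = c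
      · rw [hd, hg.1 c (by simp), hg'.1 c (by simp)]
      · have h1 := congrFun h0 d
        rwa [Function.update_of_ne hd, Function.update_of_ne hd] at h1
    subst hgg
    rfl
  · rintro ⟨f, hf⟩
    have hsurj : ∃ c ∈ S, f c = S.card - 1 := by
      have himg : S.image f = Finset.range S.card := by
        apply Finset.eq_of_subset_of_card_le
        · intro y hy
          obtain ⟨c, hc, rfl⟩ := Finset.mem_image.1 hy
          exact Finset.mem_range.2 (hf.2.1 c hc)
        · rw [Finset.card_image_of_injOn hf.2.2.1, Finset.card_range]
      have : S.card - 1 ∈ S.image f := by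
        rw [himg, Finset.mem_range]; omega
      simpa using this
    obtain ⟨c, hcS, hfc⟩ := hsurj
    have hc : c ∈ maxc S := by
      refine Finset.mem_filter.2 ⟨hcS, fun d hd h1 h2 => ?_⟩
      by_contra hne
      have h3 := hf.2.2.2 c hcS d hd h1 h2 (Ne.symm hne)
      have h4 := hf.2.1 d hd
      omega
    refine ⟨⟨⟨c, hc⟩, ⟨Function.update f c 0, ?_, ?_, ?_, ?_⟩⟩, ?_⟩
    · intro d hd
      by_cases h : d = c
      · simp [h]
      · rw [Function.update_of_ne h]
        exact hf.1 d (fun hdS => hd (Finset.mem_erase.2 ⟨h, hdS⟩))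
    · intro d hd
      obtain ⟨h, hdS⟩ := Finset.mem_erase.1 hd
      rw [Function.update_of_ne h, Finset.card_erase_of_mem hcS]
      have h4 := hf.2.1 d hdS
      have h5 : f d ≠ f c := fun e => h (hf.2.2.1 hdS hcS e)
      omega
    · intro a ha b hb hab
      obtain ⟨h1, haS⟩ := Finset.mem_erase.1 (Finset.mem_coe.1 ha)
      obtain ⟨h2, hbS⟩ := Finset.mem_erase.1 (Finset.mem_coe.1 hb)
      rw [Function.update_of_ne h1, Function.update_of_ne h2] at hab
      exact hf.2.2.1 haS hbS hab
    · intro a ha b hb l1 l2 hne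
      obtain ⟨h1, haS⟩ := Finset.mem_erase.1 ha
      obtain ⟨h2, hbS⟩ := Finset.mem_erase.1 hb
      rw [Function.update_of_ne h1, Function.update_of_ne h2]
      exact hf.2.2.2 a haS b hbS l1 l2 hne
    · apply Subtype.ext
      change Function.update (Function.update f c 0) c (S.card - 1) = f
      rw [Function.update_idem, ← hfc, Function.update_eq_self]

theorem prod_cells {M : Type*} [CommMonoid M] (μ : YoungDiagram) (k : ℕ) (hk : μ.rowLen k = 0)
    (g : ℕ × ℕ → M) :
    ∏ c ∈ μ.cells, g c = ∏ i : Fin k, ∏ j ∈ Finset.range (μ.rowLen i), g (i, j) := by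
  rw [Fin.prod_univ_eq_prod_range (fun i => ∏ j ∈ Finset.range (μ.rowLen i), g (i, j)) k,
    Finset.prod_sigma']
  refine Finset.prod_nbij' (fun c => ⟨c.1, c.2⟩) (fun p => (p.1, p.2)) ?_ ?_ ?_ ?_ ?_
  · rintro ⟨i, j⟩ h
    rw [YoungDiagram.mem_cells, YoungDiagram.mem_iff_lt_rowLen] at h
    simp only [Finset.mem_sigma, Finset.mem_range]
    refine ⟨?_, h⟩
    by_contra hc
    have := μ.rowLen_anti k i (by omega)
    omega
  · rintro ⟨i, j⟩ h
    simp only [Finset.mem_sigma, Finset.mem_range] at h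
    rw [YoungDiagram.mem_cells, YoungDiagram.mem_iff_lt_rowLen]
    exact h.2
  · intro c _; rfl
  · intro c _; rfl
  · intro c _; rfl

theorem card_cells (μ : YoungDiagram) (k : ℕ) (hk : μ.rowLen k = 0) :
    μ.card = ∑ i : Fin k, μ.rowLen i := by
  have h := prod_cells (M := Multiplicative ℕ) μ k hk (fun _ => Multiplicative.ofAdd 1)
  simp only [Finset.prod_const, Finset.card_range] at h
  have h2 := congrArg Multiplicative.toAdd h
  simpa using h2

/-- shifted row length -/
def xr (μ : YoungDiagram) (k : ℕ) (i : ℕ) : ℕ := μ.rowLen i + (k - 1 - i)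

theorem row_hook (μ : YoungDiagram) (k : ℕ) (hk : μ.rowLen k = 0) (i : ℕ) (hi : i < k) :
    (∏ j ∈ Finset.range (μ.rowLen i), hookLen μ (i, j)) *
      (∏ m ∈ Finset.Ioo i k, (xr μ k i - xr μ k m)) = (xr μ k i).factorial := by
  have hA : ∀ a b, b < μ.rowLen a ↔ a < μ.colLen b := fun a b => by
    rw [← YoungDiagram.mem_iff_lt_rowLen, YoungDiagram.mem_iff_lt_colLen]
  have hcolk : ∀ b, μ.colLen b ≤ k := by
    intro b
    by_contra h
    have := (hA k b).2 (by omega)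
    omega
  have inj1 : Set.InjOn (fun j => hookLen μ (i, j)) (Finset.range (μ.rowLen i)) := by
    have aux : ∀ a b, a < b → b < μ.rowLen i → hookLen μ (i, b) < hookLen μ (i, a) := by
      intro a b hab hb
      have := μ.colLen_anti a b hab.le
      have := (hA i b).1 hb
      simp only [hookLen]
      omega
    intro a ha b hb hab
    simp only [Finset.coe_range, Set.mem_Iio] at ha hb hab
    rcases lt_trichotomy a b with h | h | h
    · have := aux a b h hb; omega
    · exact h
    · have := aux b a h ha; omega
  have inj2 : Set.InjOn (fun m => xr μ k i - xr μ k m) (Finset.Ioo i k) := by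
    have aux : ∀ a b, i < a → a < b → b < k → xr μ k i - xr μ k a < xr μ k i - xr μ k b := by
      intro a b ha hab hb
      have := μ.rowLen_anti i a ha.le
      have := μ.rowLen_anti a b hab.le
      simp only [xr]
      omega
    intro a ha b hb hab
    simp only [Finset.coe_Ioo, Set.mem_Ioo] at ha hb hab
    rcases lt_trichotomy a b with h | h | h
    · have := aux a b ha.1 h hb.2; omega
    · exact h
    · have := aux b a hb.1 h ha.2; omega
  have disj : Disjoint ((Finset.range (μ.rowLen i)).image (fun j => hookLen μ (i, j)))
      ((Finset.Ioo i k).image (fun m => xr μ k i - xr μ k m)) := by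
    rw [Finset.disjoint_left]
    intro y h1 h2
    obtain ⟨j, hj, rfl⟩ := Finset.mem_image.1 h1
    obtain ⟨m, hm, he⟩ := Finset.mem_image.1 h2
    rw [Finset.mem_range] at hj
    rw [Finset.mem_Ioo] at hm
    have := μ.rowLen_anti i m hm.1.le
    have := (hA i j).1 hj
    have := hA m j
    simp only [xr, hookLen] at he
    omega
  have himg : ((Finset.range (μ.rowLen i)).image (fun j => hookLen μ (i, j))) ∪
      ((Finset.Ioo i k).image (fun m => xr μ k i - xr μ k m)) = Finset.Icc 1 (xr μ k i) := by
    apply Finset.eq_of_subset_of_card_le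
    · intro y hy
      rw [Finset.mem_union] at hy
      rw [Finset.mem_Icc]
      rcases hy with h1 | h2
      · obtain ⟨j, hj, rfl⟩ := Finset.mem_image.1 h1
        rw [Finset.mem_range] at hj
        have := (hA i j).1 hj
        have := hcolk j
        simp only [xr, hookLen]
        omega
      · obtain ⟨m, hm, rfl⟩ := Finset.mem_image.1 h2
        rw [Finset.mem_Ioo] at hm
        have := μ.rowLen_anti i m hm.1.le
        simp only [xr]
        omega
    · rw [Finset.card_union_of_disjoint disj, Finset.card_image_of_injOn inj1,
        Finset.card_image_of_injOn inj2]
      simp only [Nat.card_Icc, Finset.card_range, Nat.card_Ioo, xr]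
      omega
  have hfact : ∀ N : ℕ, ∏ x ∈ Finset.Icc 1 N, x = N.factorial := by
    intro N
    induction N with
    | zero => simp
    | succ N ih => rw [Finset.prod_Icc_succ_top (by omega), ih, Nat.factorial_succ, mul_comm]
  rw [← hfact, ← himg, Finset.prod_union disj,
    Finset.prod_image inj1, Finset.prod_image inj2]

theorem xr_lt (μ : YoungDiagram) (k i j : ℕ) (hij : i < j) (hj : j < k) :
    xr μ k j < xr μ k i := by
  have := μ.rowLen_anti i j hij.le
  simp only [xr]
  omega

theorem hook_vdm (μ : YoungDiagram) (k : ℕ) (hk : μ.rowLen k = 0) :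
    (∏ c ∈ μ.cells, (hookLen μ c : ℝ)) * vdm (fun i : Fin k => (xr μ k i : ℝ)) =
      ∏ i : Fin k, ((xr μ k i).factorial : ℝ) := by
  rw [prod_cells μ k hk]
  unfold vdm
  rw [← Finset.prod_mul_distrib]
  refine Finset.prod_congr rfl fun i _ => ?_
  rw [← row_hook μ k hk i i.2]
  push_cast
  congr 1
  refine Finset.prod_nbij (fun j : Fin k => (j : ℕ)) ?_ ?_ ?_ ?_
  · intro j hj
    rw [Finset.mem_Ioi] at hj
    exact Finset.mem_Ioo.2 ⟨hj, j.2⟩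
  · intro a _ b _ h
    exact Fin.ext h
  · intro m hm
    have hm' := Finset.mem_Ioo.1 (Finset.mem_coe.1 hm)
    exact ⟨⟨m, hm'.2⟩, by simpa [Fin.lt_def] using hm'.1, rfl⟩
  · intro j hj
    rw [Finset.mem_Ioi] at hj
    rw [Nat.cast_sub (xr_lt μ k i j hj j.2).le]

theorem vdm_pos (μ : YoungDiagram) (k : ℕ) : 0 < vdm (fun i : Fin k => (xr μ k i : ℝ)) := by
  unfold vdm
  refine Finset.prod_pos fun i _ => Finset.prod_pos fun j hj => ?_
  rw [Finset.mem_Ioi] at hj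
  have := xr_lt μ k i j hj j.2
  exact sub_pos.2 (Nat.cast_lt.2 this)

theorem vdm_zero {k : ℕ} (x : Fin k → ℝ) (i j : Fin k) (hij : i < j) (h : x i = x j) :
    vdm x = 0 := by
  unfold vdm
  refine Finset.prod_eq_zero (Finset.mem_univ i) (Finset.prod_eq_zero (Finset.mem_Ioi.2 hij) ?_)
  rw [h, sub_self]

/-- remove a corner -/
def rmc (μ : YoungDiagram) (i : ℕ) (h : μ.rowLen (i + 1) < μ.rowLen i) : YoungDiagram where
  cells := μ.cells.erase (i, μ.rowLen i - 1)
  isLowerSet := by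
    rintro ⟨a, b⟩ ⟨c, d⟩ hle hm
    have h1 : c ≤ a := hle.1
    have h2 : d ≤ b := hle.2
    simp only [Finset.coe_erase, Set.mem_sdiff, Finset.mem_coe, YoungDiagram.mem_cells,
      Set.mem_singleton_iff, Prod.mk.injEq, YoungDiagram.mem_iff_lt_rowLen] at hm ⊢
    have h3 := μ.rowLen_anti c a h1
    refine ⟨by omega, ?_⟩
    rintro ⟨rfl, rfl⟩
    rcases Nat.eq_or_lt_of_le h1 with e | e
    · subst e; omega
    · have := μ.rowLen_anti (c + 1) a e
      omega

theorem rowLen_rmc (μ : YoungDiagram) (i : ℕ) (h : μ.rowLen (i + 1) < μ.rowLen i) (a : ℕ) :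
    (rmc μ i h).rowLen a = if a = i then μ.rowLen i - 1 else μ.rowLen a := by
  have key : ∀ b, b < (rmc μ i h).rowLen a ↔
      b < (if a = i then μ.rowLen i - 1 else μ.rowLen a) := by
    intro b
    rw [← YoungDiagram.mem_iff_lt_rowLen, ← YoungDiagram.mem_cells]
    simp only [rmc, Finset.mem_erase, YoungDiagram.mem_cells, YoungDiagram.mem_iff_lt_rowLen,
      ne_eq, Prod.mk.injEq]
    split_ifs with e
    · subst e; omega
    · simp [e]
  apply le_antisymm
  · by_contra hc
    have := (key _).1 (not_le.1 hc)
    omega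
  · by_contra hc
    have := (key _).2 (not_le.1 hc)
    omega

theorem sum_maxc (μ : YoungDiagram) (k : ℕ) (hk : μ.rowLen k = 0) (g : ℕ × ℕ → ℝ) :
    ∑ c ∈ maxc μ.cells, g c =
      ∑ i : Fin k, if μ.rowLen (i + 1) < μ.rowLen i then g (i, μ.rowLen i - 1) else 0 := by
  rw [Fin.sum_univ_eq_sum_range
    (fun i => if μ.rowLen (i + 1) < μ.rowLen i then g (i, μ.rowLen i - 1) else 0) k,
    ← Finset.sum_filter]
  have hmem : ∀ a b, (a, b) ∈ maxc μ.cells →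
      a < k ∧ μ.rowLen (a + 1) < μ.rowLen a ∧ b = μ.rowLen a - 1 := by
    intro a b h
    obtain ⟨h1, h2⟩ := Finset.mem_filter.1 h
    rw [YoungDiagram.mem_cells, YoungDiagram.mem_iff_lt_rowLen] at h1
    have h3 : b = μ.rowLen a - 1 := by
      by_contra hne
      have := h2 (a, b + 1) (by
        rw [YoungDiagram.mem_cells, YoungDiagram.mem_iff_lt_rowLen]; omega) le_rfl (by simp)
      simp at this
    refine ⟨?_, ?_, h3⟩
    · by_contra hc
      have := μ.rowLen_anti k a (by omega)
      omega
    · by_contra hc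
      have := h2 (a + 1, b) (by
        rw [YoungDiagram.mem_cells, YoungDiagram.mem_iff_lt_rowLen]; omega) (by simp) le_rfl
      simp at this
  refine Finset.sum_nbij' (fun c => c.1) (fun i => (i, μ.rowLen i - 1)) ?_ ?_ ?_ ?_ ?_
  · rintro ⟨a, b⟩ h
    obtain ⟨h1, h2, h3⟩ := hmem a b h
    exact Finset.mem_filter.2 ⟨Finset.mem_range.2 h1, h2⟩
  · intro i hi
    obtain ⟨h1, h2⟩ := Finset.mem_filter.1 hi
    refine Finset.mem_filter.2 ⟨?_, ?_⟩
    · rw [YoungDiagram.mem_cells, YoungDiagram.mem_iff_lt_rowLen]; omega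
    · rintro ⟨a, b⟩ hd l1 l2
      rw [YoungDiagram.mem_cells, YoungDiagram.mem_iff_lt_rowLen] at hd
      simp only at l1 l2
      have := μ.rowLen_anti i a l1
      rcases Nat.eq_or_lt_of_le l1 with e | e
      · subst e
        simp only [Prod.mk.injEq, true_and]
        omega
      · have := μ.rowLen_anti (i + 1) a e
        omega
  · rintro ⟨a, b⟩ h
    obtain ⟨h1, h2, h3⟩ := hmem a b h
    simp [h3]
  · intro i _; rfl
  · rintro ⟨a, b⟩ h
    obtain ⟨h1, h2, h3⟩ := hmem a b h
    simp [h3]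

theorem TS_formula (k n : ℕ) : ∀ μ : YoungDiagram, μ.card = n → μ.rowLen k = 0 →
    (Nat.card (TS μ.cells) : ℝ) * ∏ i : Fin k, ((xr μ k i).factorial : ℝ) =
      (n.factorial : ℝ) * vdm (fun i : Fin k => (xr μ k i : ℝ)) := by
  induction n with
  | zero =>
    intro μ hμ hk
    have he : μ.cells = ∅ := Finset.card_eq_zero.1 hμ
    rw [← hook_vdm μ k hk, he]
    have : Nat.card (TS ∅) = 1 := by
      rw [Nat.card_eq_one_iff_unique]
      refine ⟨⟨?_⟩, ⟨fun _ => 0, ?_⟩⟩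
      · rintro ⟨f, hf⟩ ⟨g, hg⟩
        ext c
        simp [hf.1 c (by simp), hg.1 c (by simp)]
      · simp [TS]
    rw [this]
    simp
  | succ n ih =>
    intro μ hμ hk
    have hne : μ.cells.Nonempty := by
      rw [← Finset.card_pos]
      have : μ.cells.card = n + 1 := hμ
      omega
    rw [TS_rec _ hne, Nat.cast_sum, sum_maxc μ k hk
      (fun c => (Nat.card (TS (μ.cells.erase c)) : ℝ)), Finset.sum_mul]
    have hterm : ∀ i : Fin k,
        (if μ.rowLen (i + 1) < μ.rowLen i then
          (Nat.card (TS (μ.cells.erase ((i : ℕ), μ.rowLen i - 1))) : ℝ) else 0) *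
          ∏ i : Fin k, ((xr μ k i).factorial : ℝ) =
        (n.factorial : ℝ) * ((xr μ k i : ℝ) * vdm (Function.update
          (fun i : Fin k => (xr μ k i : ℝ)) i ((xr μ k i : ℝ) - 1))) := by
      intro i
      split_ifs with hc
      · have hcard : (rmc μ i hc).card = n := by
          change (μ.cells.erase _).card = n
          rw [Finset.card_erase_of_mem]
          · have : μ.cells.card = n + 1 := hμ
            omega
          · rw [YoungDiagram.mem_cells, YoungDiagram.mem_iff_lt_rowLen]; omega
        have hk' : (rmc μ i hc).rowLen k = 0 := by
          rw [rowLen_rmc, if_neg (by have := i.2; omega), hk]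
        have h1 := ih (rmc μ i hc) hcard hk'
        have hx : ∀ a : Fin k, xr (rmc μ i hc) k a =
            Function.update (fun a : Fin k => xr μ k a) i (xr μ k i - 1) a := by
          intro a
          by_cases e : a = i
          · subst e
            simp only [xr, rowLen_rmc, if_true, Function.update_self]
            omega
          · have e' : (a : ℕ) ≠ i := fun h => e (Fin.ext h)
            simp only [xr, rowLen_rmc, if_neg e', Function.update_of_ne e]
        have hpos : 0 < xr μ k i := by simp only [xr]; omega
        have hx2 : (fun a : Fin k => (xr (rmc μ i hc) k a : ℝ)) = Function.update
          (fun i : Fin k => (xr μ k i : ℝ)) i ((xr μ k i : ℝ) - 1) := by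
          funext a
          rw [hx]
          by_cases e : a = i
          · subst e
            simp only [Function.update_self]
            rw [Nat.cast_sub hpos]; simp
          · simp only [Function.update_of_ne e]
        have hprod : ∏ a : Fin k, ((xr μ k a).factorial : ℝ) =
            (xr μ k i : ℝ) * ∏ a : Fin k, ((xr (rmc μ i hc) k a).factorial : ℝ) := by
          rw [← Finset.mul_prod_erase _ _ (Finset.mem_univ i),
            ← Finset.mul_prod_erase _ (fun a : Fin k => ((xr (rmc μ i hc) k a).factorial : ℝ))
              (Finset.mem_univ i), ← mul_assoc]
          congr 1
          · rw [hx, Function.update_self]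
            exact_mod_cast (Nat.mul_factorial_pred hpos.ne').symm
          · refine Finset.prod_congr rfl fun a ha => ?_
            rw [hx, Function.update_of_ne (Finset.ne_of_mem_erase ha)]
        rw [hx2] at h1
        rw [hprod]
        have hcells : (rmc μ i hc).cells = μ.cells.erase ((i : ℕ), μ.rowLen i - 1) := rfl
        rw [hcells] at h1
        linear_combination (xr μ k i : ℝ) * h1
      · have hle := μ.rowLen_anti i (i + 1) (by omega)
        rw [zero_mul]
        by_cases hik : (i : ℕ) + 1 < k
        · rw [vdm_zero _ i ⟨i + 1, hik⟩ (by simp [Fin.lt_def])]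
          · simp
          · have e : (⟨i + 1, hik⟩ : Fin k) ≠ i := by
              intro h; have := congrArg Fin.val h; simp at this
            rw [Function.update_self, Function.update_of_ne e]
            have : xr μ k i = xr μ k (i + 1) + 1 := by simp only [xr]; omega
            simp [this]
        · have hik' : (i : ℕ) + 1 = k := by have := i.2; omega
          rw [hik'] at hc
          have : xr μ k i = 0 := by simp only [xr]; omega
          simp [this]
    rw [Finset.sum_congr rfl fun i _ => hterm i, ← Finset.mul_sum, vdm_sum]
    have hs : (∑ i : Fin k, (xr μ k i : ℝ)) - ∑ i : Fin k, ((i : ℕ) : ℝ) = n + 1 := by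
      have h1 : ∑ i : Fin k, ((k - 1 - i : ℕ) : ℝ) = ∑ i : Fin k, ((i : ℕ) : ℝ) := by
        rw [Fin.sum_univ_eq_sum_range (fun i => ((k - 1 - i : ℕ) : ℝ)) k,
          Fin.sum_univ_eq_sum_range (fun i => (i : ℝ)) k,
          Finset.sum_range_reflect (fun i => (i : ℝ)) k]
      have h2 := card_cells μ k hk
      rw [hμ] at h2
      have h3 : ((n + 1 : ℕ) : ℝ) = ∑ i : Fin k, (μ.rowLen i : ℝ) := by
        rw [h2]; push_cast; rfl
      simp only [xr, Nat.cast_add, Finset.sum_add_distrib]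
      rw [h1, ← h3]
      push_cast
      ring
    rw [hs, Nat.factorial_succ]
    push_cast
    ring

theorem exists_rowLen_zero (μ : YoungDiagram) : μ.rowLen (μ.colLen 0) = 0 := by
  by_contra h
  have := YoungDiagram.mem_iff_lt_rowLen.2 (Nat.pos_of_ne_zero h)
  rw [YoungDiagram.mem_iff_lt_colLen] at this
  omega

theorem hook_pos (μ : YoungDiagram) (c : ℕ × ℕ) (hc : c ∈ μ.cells) : 0 < hookLen μ c := by
  obtain ⟨a, b⟩ := c
  rw [YoungDiagram.mem_cells] at hc
  have h1 := YoungDiagram.mem_iff_lt_rowLen.1 hc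
  have h2 := YoungDiagram.mem_iff_lt_colLen.1 hc
  simp only [hookLen]
  omega

theorem hook_length_formula (μ : YoungDiagram) :
    (numSYT μ : ℝ) * ∏ c ∈ μ.cells, (hookLen μ c : ℝ) = (μ.card.factorial : ℝ) := by
  have hk := exists_rowLen_zero μ
  have h1 := TS_formula _ _ μ rfl hk
  rw [← hook_vdm μ _ hk, ← numSYT_eq] at h1
  have h2 := vdm_pos μ (μ.colLen 0)
  apply mul_right_cancel₀ h2.ne'
  linear_combination h1

/-- with λ a partition of n with first row of length n − ℓ,
    ℓ < n/2, and λ₁ obtained by removing the last cell of the first row,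
    dim ρ_{λ₁}/dim ρ_λ = (1/n)·(∏_{x∈λ} h_λ(x))/(∏_{x∈λ₁} h_{λ₁}(x)),
    and this ratio is at least
    (∏_{i=1}^{n−2ℓ−1} (i+1)/i)·(1/n) = (n−2ℓ)/n. -/
theorem stmt5 (n ℓ : ℕ) (hn : 0 < n) (hℓ : 2 * ℓ < n)
    (lam lam₁ : YoungDiagram)
    (hcard : lam.card = n)
    (hrow : lam.rowLen 0 = n - ℓ)
    (hdel : lam₁.cells = lam.cells.erase (0, lam.rowLen 0 - 1)) :
    (numSYT lam₁ : ℝ) / (numSYT lam : ℝ) =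
        (1 / n) * ((∏ x ∈ lam.cells, (hookLen lam x : ℝ)) /
          (∏ x ∈ lam₁.cells, (hookLen lam₁ x : ℝ))) ∧
    ((∏ i ∈ Finset.Icc 1 (n - 2 * ℓ - 1), ((i : ℝ) + 1) / i) * (1 / n) =
        ((n : ℝ) - 2 * ℓ) / n) ∧
    ((n : ℝ) - 2 * ℓ) / n ≤ (numSYT lam₁ : ℝ) / (numSYT lam : ℝ) := by
  have hpos : ∀ μ : YoungDiagram, 0 < ∏ x ∈ μ.cells, (hookLen μ x : ℝ) := fun μ =>
    Finset.prod_pos fun c hc => by exact_mod_cast hook_pos μ c hc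
  have hnR : (0 : ℝ) < n := by exact_mod_cast hn
  have hrowpos : 0 < lam.rowLen 0 := by omega
  have hlast : ((0 : ℕ), lam.rowLen 0 - 1) ∈ lam.cells := by
    rw [YoungDiagram.mem_cells, YoungDiagram.mem_iff_lt_rowLen]; omega
  have hcard1 : lam₁.card + 1 = n := by
    have h : lam₁.cells.card = _ := congrArg Finset.card hdel
    rw [Finset.card_erase_of_mem hlast] at h
    have h0 : lam.cells.card = n := hcard
    have : lam₁.card = lam₁.cells.card := rfl
    omega
  have hA := hook_length_formula lam
  have hB := hook_length_formula lam₁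
  have hP := hpos lam
  have hP1 := hpos lam₁
  have hfac : (lam.card.factorial : ℝ) = n * (lam₁.card.factorial : ℝ) := by
    rw [hcard, ← hcard1, Nat.factorial_succ]; push_cast; ring
  have hf1 : (0 : ℝ) < (lam₁.card.factorial : ℝ) := by exact_mod_cast Nat.factorial_pos _
  have hpart1 : (numSYT lam₁ : ℝ) / (numSYT lam : ℝ) =
        (1 / n) * ((∏ x ∈ lam.cells, (hookLen lam x : ℝ)) /
          (∏ x ∈ lam₁.cells, (hookLen lam₁ x : ℝ))) := by
    have e1 := eq_div_of_mul_eq hP.ne' hA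
    have e2 := eq_div_of_mul_eq hP1.ne' hB
    rw [e1, e2, hfac]
    field_simp
  have hcast : (((n - 2 * ℓ - 1 : ℕ) : ℝ) + 1) = (n : ℝ) - 2 * ℓ := by
    have : (n - 2 * ℓ - 1) + 1 + 2 * ℓ = n := by omega
    have h : (((n - 2 * ℓ - 1) + 1 + 2 * ℓ : ℕ) : ℝ) = (n : ℝ) := congrArg _ this
    push_cast at h
    linarith
  have htel : ∀ N : ℕ, ∏ i ∈ Finset.Icc 1 N, ((i : ℝ) + 1) / i = (N : ℝ) + 1 := by
    intro N
    induction N with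
    | zero => simp
    | succ N ih =>
      rw [Finset.prod_Icc_succ_top (by omega), ih]
      push_cast
      field_simp
  refine ⟨hpart1, ?_, ?_⟩
  · rw [htel, hcast]; ring
  · rw [hpart1]
    have hcol : ∀ a b, b < lam.rowLen a ↔ a < lam.colLen b := fun a b => by
      rw [← YoungDiagram.mem_iff_lt_rowLen, YoungDiagram.mem_iff_lt_colLen]
    have hcol1 : ∀ a b, b < lam₁.rowLen a ↔ a < lam₁.colLen b := fun a b => by
      rw [← YoungDiagram.mem_iff_lt_rowLen, YoungDiagram.mem_iff_lt_colLen]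
    have hrow1 : lam.rowLen 1 ≤ ℓ := by
      have h1 := card_cells lam _ (exists_rowLen_zero lam)
      have h2 : lam.rowLen 0 + lam.rowLen 1 ≤ lam.card := by
        rw [lam.rowLen_eq_card, lam.rowLen_eq_card, ← Finset.card_union_of_disjoint]
        · apply Finset.card_le_card
          intro c hc
          rcases Finset.mem_union.1 hc with h | h
          · exact (YoungDiagram.mem_row_iff.1 h).1
          · exact (YoungDiagram.mem_row_iff.1 h).1
        · rw [Finset.disjoint_left]
          intro c h h'
          have := (YoungDiagram.mem_row_iff.1 h).2
          have := (YoungDiagram.mem_row_iff.1 h').2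
          omega
      omega
    have hc : lam.rowLen (0 + 1) < lam.rowLen 0 := by
      rw [zero_add]; omega
    have heq : lam₁ = rmc lam 0 hc := YoungDiagram.ext hdel
    have hrl : ∀ a, lam₁.rowLen a = if a = 0 then lam.rowLen 0 - 1 else lam.rowLen a := by
      intro a; rw [heq]; exact rowLen_rmc lam 0 hc a
    have hcl : ∀ b, b ≠ lam.rowLen 0 - 1 → lam₁.colLen b = lam.colLen b := by
      intro b hb
      have key : ∀ a, a < lam₁.colLen b ↔ a < lam.colLen b := by
        intro a
        rw [← hcol, ← hcol1, hrl]
        split_ifs with e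
        · subst e; omega
        · rfl
      apply le_antisymm
      · by_contra hh
        have := (key _).1 (not_le.1 hh)
        omega
      · by_contra hh
        have := (key _).2 (not_le.1 hh)
        omega
    have hmem1 : ∀ a b, (a, b) ∈ lam₁.cells ↔ b < (if a = 0 then lam.rowLen 0 - 1 else lam.rowLen a) := by
      intro a b
      rw [YoungDiagram.mem_cells, YoungDiagram.mem_iff_lt_rowLen, hrl]
    have hbnd : ∀ a b, (a, b) ∈ lam₁.cells → b < lam.rowLen 0 - 1 := by
      intro a b h
      rw [hmem1] at h
      split_ifs at h with e
      · exact h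
      · have := lam.rowLen_anti 1 a (by omega)
        omega
    have hlasth : hookLen lam (0, lam.rowLen 0 - 1) = 1 := by
      have h1 := hcol 1 (lam.rowLen 0 - 1)
      have h2 := hcol 0 (lam.rowLen 0 - 1)
      rw [zero_add] at hc
      simp only [hookLen]
      omega
    have hratio : (∏ x ∈ lam.cells, (hookLen lam x : ℝ)) /
          (∏ x ∈ lam₁.cells, (hookLen lam₁ x : ℝ)) =
          ∏ x ∈ lam₁.cells, ((hookLen lam x : ℝ) / (hookLen lam₁ x : ℝ)) := by
      rw [← Finset.mul_prod_erase _ _ hlast, hlasth, ← hdel, Finset.prod_div_distrib]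
      simp
    have hmain : (n : ℝ) - 2 * ℓ ≤
        ∏ x ∈ lam₁.cells, ((hookLen lam x : ℝ) / (hookLen lam₁ x : ℝ)) := by
      rw [← hcast, ← htel]
      have hre : ∏ i ∈ Finset.Icc 1 (n - 2 * ℓ - 1), ((i : ℝ) + 1) / i =
          ∏ x ∈ lam₁.cells, if x.1 = 0 ∧ ℓ ≤ x.2 then
            (((n - ℓ - 1 - x.2 : ℕ) : ℝ) + 1) / ((n - ℓ - 1 - x.2 : ℕ) : ℝ) else 1 := by
        rw [← Finset.prod_filter]
        refine Finset.prod_nbij' (fun i => (0, n - ℓ - 1 - i)) (fun x => n - ℓ - 1 - x.2)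
          ?_ ?_ ?_ ?_ ?_
        · intro i hi
          rw [Finset.mem_Icc] at hi
          rw [Finset.mem_filter, hmem1]
          simp only [if_true, true_and]
          omega
        · rintro ⟨a, b⟩ h
          rw [Finset.mem_filter] at h
          have := hbnd a b h.1
          have h2 : ℓ ≤ b := h.2.2
          rw [Finset.mem_Icc]
          omega
        · intro i hi
          rw [Finset.mem_Icc] at hi
          simp only
          omega
        · rintro ⟨a, b⟩ h
          rw [Finset.mem_filter] at h
          have := hbnd a b h.1
          have h2 : ℓ ≤ b := h.2.2
          have h3 : a = 0 := h.2.1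
          simp only [Prod.mk.injEq]
          omega
        · intro i hi
          rw [Finset.mem_Icc] at hi
          have : n - ℓ - 1 - (n - ℓ - 1 - i) = i := by omega
          simp only [this]
      rw [hre]
      refine Finset.prod_le_prod ?_ ?_
      · intro x _
        split_ifs <;> positivity
      · rintro ⟨a, b⟩ hx
        have hb := hbnd a b hx
        have hp := hook_pos lam₁ _ hx
        have hpR : (0 : ℝ) < (hookLen lam₁ (a, b) : ℝ) := by exact_mod_cast hp
        split_ifs with hcond
        · obtain ⟨h0, h2⟩ := hcond
          simp only at h0 h2
          subst h0
          have h1 := hcol 1 b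
          have h3 := hcol 0 b
          have e1 : hookLen lam (0, b) = (n - ℓ - 1 - b) + 1 := by
            simp only [hookLen]; omega
          have e2 : hookLen lam₁ (0, b) = n - ℓ - 1 - b := by
            simp only [hookLen, hrl, hcl b hb.ne, if_true]; omega
          rw [e1, e2]
          push_cast
          exact le_rfl
        · rw [le_div_iff₀ hpR, one_mul]
          have : hookLen lam₁ (a, b) ≤ hookLen lam (a, b) := by
            simp only [hookLen, hcl b hb.ne, hrl]
            split_ifs with e
            · subst e; omega
            · exact le_rfl
          exact_mod_cast this
    rw [hratio, div_eq_mul_one_div, mul_comm]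
    exact mul_le_mul_of_nonneg_left hmain (by positivity)
end

section
/- Let ρ: S_M → U(N) be a unitary representation acting on ℂ^N that permutes a collection 𝒳 of M subspaces of ℂ^N transitively according to the natural action of S_M on M points (i.e., ρ(π)(X_i) = X_{π(i)}). Then for any two subspaces X, Y ∈ 𝒳, dim X − dim(X ∩ Y) ≤ (2cn/M)·N, where n = log₂ N and c is the absolute constant such that every irreducible constituent of an N-dimensional representation of S_M has first row or column of length > M − cn. -/
open Module in
theorem aux_decomp {V : Type*} [AddCommGroup V] [Module ℂ V] [FiniteDimensional ℂ V]
    (z : ℂ) (hz : z ^ 2 + z + 1 = 0) (g : End ℂ V) (hg : g ^ 3 = 1) (W : Submodule ℂ V)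
    (hW : ∀ v ∈ W, g v ∈ W) :
    finrank ℂ W = finrank ℂ ↥(W ⊓ LinearMap.ker (g - 1)) +
      finrank ℂ ↥(W ⊓ LinearMap.ker (g - z • (1 : End ℂ V))) +
      finrank ℂ ↥(W ⊓ LinearMap.ker (g - z ^ 2 • (1 : End ℂ V))) := by
  have hg' : ∀ v, g (g (g v)) = v := fun v => by
    have := congrArg (fun f : End ℂ V => f v) hg
    simpa [pow_succ] using this
  have hz3 : z ^ 3 = 1 := by linear_combination (z - 1) * hz
  have hz1 : z ≠ 1 := by rintro rfl; norm_num at hz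
  have hz0 : z ≠ 0 := by rintro rfl; norm_num at hz
  set A := W ⊓ LinearMap.ker (g - 1) with hA
  set B := W ⊓ LinearMap.ker (g - z • (1 : End ℂ V)) with hB
  set C := W ⊓ LinearMap.ker (g - z ^ 2 • (1 : End ℂ V)) with hC
  have mA : ∀ v, v ∈ A ↔ v ∈ W ∧ g v = v := fun v => by simp [hA, sub_eq_zero]
  have mB : ∀ v, v ∈ B ↔ v ∈ W ∧ g v = z • v := fun v => by simp [hB, sub_eq_zero]
  have mC : ∀ v, v ∈ C ↔ v ∈ W ∧ g v = z ^ 2 • v := fun v => by simp [hC, sub_eq_zero]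
  have h1 : A ⊓ B = ⊥ := by
    rw [eq_bot_iff]
    rintro v ⟨ha, hb⟩
    have ha := ((mA v).1 ha).2
    have hb := ((mB v).1 hb).2
    have : (z - 1) • v = 0 := by rw [sub_smul, ← hb, ha]; simp
    simpa [sub_eq_zero, hz1] using this
  have h2 : (A ⊔ B) ⊓ C = ⊥ := by
    rw [eq_bot_iff]
    rintro v ⟨hab, hc⟩
    obtain ⟨a, ha, b, hb, rfl⟩ := Submodule.mem_sup.1 hab
    have ha := ((mA a).1 ha).2
    have hb := ((mB b).1 hb).2
    have hc := ((mC _).1 hc).2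
    rw [map_add, ha, hb] at hc
    have hc2 := congrArg g hc
    simp only [map_add, map_smul, ha, hb] at hc2
    have e1 : (1 - z ^ 2) • a + (z - z ^ 2) • b = 0 := by
      have := sub_eq_zero.2 hc
      rw [← this]; module
    have e2 : (1 - z ^ 2) • a + (z ^ 2 - z ^ 3) • b = 0 := by
      have := sub_eq_zero.2 hc2
      rw [← this]; module
    have e3 : ((z - z ^ 2) - (z ^ 2 - z ^ 3)) • b = 0 := by
      have : ((z - z ^ 2) - (z ^ 2 - z ^ 3)) • b = ((1 - z ^ 2) • a + (z - z ^ 2) • b) -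
        ((1 - z ^ 2) • a + (z ^ 2 - z ^ 3) • b) := by module
      rw [this, e1, e2, sub_zero]
    have hne : (z - z ^ 2) - (z ^ 2 - z ^ 3) ≠ 0 := by
      have : (z - z ^ 2) - (z ^ 2 - z ^ 3) = z * (z - 1) ^ 2 := by ring
      rw [this]
      exact mul_ne_zero hz0 (pow_ne_zero _ (sub_ne_zero.2 hz1))
    have hb0 : b = 0 := (smul_eq_zero.1 e3).resolve_left hne
    have hne2 : (1 - z ^ 2) ≠ 0 := by
      intro h
      have : (z - 1) * (z ^ 2) = 0 := by linear_combination hz3 + h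
      exact mul_ne_zero (sub_ne_zero.2 hz1) (pow_ne_zero _ hz0) this
    rw [hb0, smul_zero, add_zero] at e1
    have ha0 : a = 0 := (smul_eq_zero.1 e1).resolve_left hne2
    simp [ha0, hb0]
  have h3 : (A ⊔ B) ⊔ C = W := by
    apply le_antisymm
    · exact sup_le (sup_le inf_le_left inf_le_left) inf_le_left
    · intro w hw
      have hw1 := hW _ hw
      have hw2 := hW _ hw1
      have e : w = ((3:ℂ)⁻¹ • (w + g w + g (g w)) + (3:ℂ)⁻¹ • (w + z ^ 2 • g w + z • g (g w))) +
          (3:ℂ)⁻¹ • (w + z • g w + z ^ 2 • g (g w)) := by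
        have : ((3:ℂ)⁻¹ • (w + g w + g (g w)) + (3:ℂ)⁻¹ • (w + z ^ 2 • g w + z • g (g w))) +
          (3:ℂ)⁻¹ • (w + z • g w + z ^ 2 • g (g w)) = w + ((3:ℂ)⁻¹ * (z ^ 2 + z + 1)) • g w
            + ((3:ℂ)⁻¹ * (z ^ 2 + z + 1)) • g (g w) := by module
        rw [this, hz]; simp
      rw [e]
      refine Submodule.add_mem_sup (Submodule.add_mem_sup ?_ ?_) ?_
      · refine Submodule.smul_mem _ _ ((mA _).2 ⟨?_, ?_⟩)
        · exact W.add_mem (W.add_mem hw hw1) hw2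
        · simp only [map_add, hg']; abel
      · refine Submodule.smul_mem _ _ ((mB _).2 ⟨?_, ?_⟩)
        · exact W.add_mem (W.add_mem hw (W.smul_mem _ hw1)) (W.smul_mem _ hw2)
        · simp only [map_add, map_smul, hg', smul_add, smul_smul]
          rw [← pow_succ', hz3, one_smul, ← pow_two]; abel
      · refine Submodule.smul_mem _ _ ((mC _).2 ⟨?_, ?_⟩)
        · exact W.add_mem (W.add_mem hw (W.smul_mem _ hw1)) (W.smul_mem _ hw2)
        · simp only [map_add, map_smul, hg', smul_add, smul_smul]
          rw [← pow_succ, hz3, one_smul, ← pow_add,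
            show z ^ (2 + 2) = z by linear_combination z * hz3]; abel
  have f1 := Submodule.finrank_sup_add_finrank_inf_eq A B
  have f2 := Submodule.finrank_sup_add_finrank_inf_eq (A ⊔ B) C
  rw [h1, finrank_bot] at f1
  rw [h2, h3, finrank_bot] at f2
  omega

theorem aux_log (a b : ℕ) : (a : ℝ) * Real.logb 2 a + b * Real.logb 2 b ≤
    ((a + b : ℕ) : ℝ) * Real.logb 2 ((a + b : ℕ) : ℝ) := by
  rcases Nat.eq_zero_or_pos a with rfl | ha
  · simp
  rcases Nat.eq_zero_or_pos b with rfl | hb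
  · simp
  have ha' : (0:ℝ) < a := by exact_mod_cast ha
  have hb' : (0:ℝ) < b := by exact_mod_cast hb
  have h1 : Real.logb 2 a ≤ Real.logb 2 ((a + b : ℕ) : ℝ) :=
    Real.logb_le_logb_of_le (by norm_num) ha' (by push_cast; linarith)
  have h2 : Real.logb 2 b ≤ Real.logb 2 ((a + b : ℕ) : ℝ) :=
    Real.logb_le_logb_of_le (by norm_num) hb' (by push_cast; linarith)
  push_cast at *
  nlinarith

theorem aux_log3 (a b : ℕ) : (a : ℝ) * Real.logb 2 a + b * Real.logb 2 b + b * Real.logb 2 b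
      + 2 * b ≤
    ((a + b + b : ℕ) : ℝ) * Real.logb 2 ((a + b + b : ℕ) : ℝ) := by
  have h := aux_log a (b + b)
  rw [← add_assoc] at h
  refine le_trans (le_of_eq ?_) h
  rcases Nat.eq_zero_or_pos b with rfl | hb
  · simp
  have hb' : (b:ℝ) ≠ 0 := by positivity
  have : ((b + b : ℕ) : ℝ) = 2 * b := by push_cast; ring
  rw [this, Real.logb_mul (by norm_num) hb', Real.logb_self_eq_one (by norm_num)]
  ring

open Module in
theorem aux_main {V : Type*} [AddCommGroup V] [Module ℂ V] [FiniteDimensional ℂ V]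
    (z : ℂ) (hz : z ^ 2 + z + 1 = 0) {ι : Type*} [DecidableEq ι] (g t : ι → End ℂ V)
    (hg : ∀ k, g k ^ 3 = 1) (ht : ∀ k, t k * t k = 1) (htg : ∀ k, t k * g k = g k ^ 2 * t k)
    (hgg : ∀ k l, k ≠ l → Commute (g k) (g l))
    (hgt : ∀ k l, k ≠ l → Commute (g k) (t l)) (s : Finset ι) :
    ∀ W : Submodule ℂ V, (∀ k ∈ s, ∀ v ∈ W, g k v ∈ W) → (∀ k ∈ s, ∀ v ∈ W, t k v ∈ W) →
    ∑ k ∈ s, ((finrank ℂ W : ℝ) - finrank ℂ ↥(W ⊓ LinearMap.ker (g k - 1))) ≤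
      finrank ℂ W * Real.logb 2 (finrank ℂ W) := by
  induction s using Finset.induction_on with
  | empty =>
    intro W _ _
    rcases Nat.eq_zero_or_pos (finrank ℂ W) with h | h
    · simp [h]
    · have : 0 ≤ Real.logb 2 (finrank ℂ W) := Real.logb_nonneg (by norm_num) (by exact_mod_cast h)
      simp only [Finset.sum_empty]
      positivity
  | insert k s hk ih =>
    intro W hWg hWt
    have hz3 : z ^ 3 = 1 := by linear_combination (z - 1) * hz
    -- invariance of eigenspaces
    have inv : ∀ (f : End ℂ V) (c : ℂ), Commute (g k) f → (∀ v ∈ W, f v ∈ W) →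
        ∀ v ∈ W ⊓ LinearMap.ker (g k - c • (1 : End ℂ V)),
          f v ∈ W ⊓ LinearMap.ker (g k - c • (1 : End ℂ V)) := by
      rintro f c hc hf v ⟨hv, hv'⟩
      refine ⟨hf v hv, ?_⟩
      have e : g k v = c • v := by simpa [sub_eq_zero] using hv'
      have e2 : g k (f v) = f (g k v) := congrArg (fun f : End ℂ V => f v) hc.eq
      simp [e2, e]
    have inv2 : ∀ l ∈ s, ∀ v ∈ W ⊓ LinearMap.ker (g l - 1), g k v ∈ W ⊓ LinearMap.ker (g l - 1) := by
      rintro l hl v ⟨hv, hv'⟩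
      have hkl : k ≠ l := fun h => hk (h ▸ hl)
      refine ⟨hWg k (by simp) v hv, ?_⟩
      have e : g l v = v := by simpa [sub_eq_zero] using hv'
      have e2 : g k (g l v) = g l (g k v) := congrArg (fun f : End ℂ V => f v) (hgg k l hkl).eq
      simp [← e2, e]
    have key : ∀ c : ℂ, _ := fun c => ih (W ⊓ LinearMap.ker (g k - c • (1 : End ℂ V)))
      (fun l hl => inv (g l) c (hgg k l (fun h => hk (h ▸ hl))) (hWg l (by simp [hl])))
      (fun l hl => inv (t l) c (hgt k l (fun h => hk (h ▸ hl))) (hWt l (by simp [hl])))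
    have d0 := aux_decomp z hz (g k) (hg k) W (hWg k (by simp))
    have dl : ∀ l ∈ s, _ := fun l hl =>
      aux_decomp z hz (g k) (hg k) (W ⊓ LinearMap.ker (g l - 1)) (inv2 l hl)
    have hbb : finrank ℂ ↥(W ⊓ LinearMap.ker (g k - z ^ 2 • (1 : End ℂ V))) =
        finrank ℂ ↥(W ⊓ LinearMap.ker (g k - z • (1 : End ℂ V))) := by
      have tt : ∀ v, t k (t k v) = v := fun v => congrArg (fun f : End ℂ V => f v) (ht k)
      have tg : ∀ v, t k (g k v) = g k (g k (t k v)) := fun v => by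
        have := congrArg (fun f : End ℂ V => f v) (htg k)
        simpa [pow_two] using this
      have tinj : Function.Injective (t k) := fun a b h => by rw [← tt a, h, tt]
      have g3 : ∀ v, g k (g k (g k v)) = v := fun v => by
        have := congrArg (fun f : End ℂ V => f v) (hg k)
        simpa [pow_succ] using this
      have le : ∀ c d : ℂ, c ^ 2 = d → 
          finrank ℂ ↥(W ⊓ LinearMap.ker (g k - c • (1 : End ℂ V))) ≤
          finrank ℂ ↥(W ⊓ LinearMap.ker (g k - d • (1 : End ℂ V))) := by
        rintro c d rfl
        have hm : ∀ v ∈ W ⊓ LinearMap.ker (g k - c • (1 : End ℂ V)),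
            t k v ∈ W ⊓ LinearMap.ker (g k - c ^ 2 • (1 : End ℂ V)) := by
          rintro v ⟨hv, hv'⟩
          refine ⟨hWt k (by simp) v hv, ?_⟩
          have e : g k v = c • v := by simpa [sub_eq_zero] using hv'
          have e2 : g k (t k v) = t k (g k (g k v)) := by rw [tg, tg, g3]
          have e3 : g k (t k v) = c ^ 2 • t k v := by
            rw [e2, e, map_smul, e, map_smul, map_smul, smul_smul, pow_two]
          simp [e3]
        refine LinearMap.finrank_le_finrank_of_injective (f := (t k).restrict hm) ?_
        intro a b hab
        have := congrArg Subtype.val hab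
        exact Subtype.ext (tinj this)
      exact le_antisymm (le _ _ (by linear_combination z * hz3)) (le _ _ rfl)
    rw [hbb] at d0
    have k1 := key 1
    have k2 := key z
    have k3 := key (z ^ 2)
    rw [hbb] at k3
    rw [one_smul] at k1
    set a := finrank ℂ ↥(W ⊓ LinearMap.ker (g k - 1)) with ha
    set b := finrank ℂ ↥(W ⊓ LinearMap.ker (g k - z • (1 : End ℂ V))) with hb
    have hs : ∑ l ∈ s, ((finrank ℂ W : ℝ) - finrank ℂ ↥(W ⊓ LinearMap.ker (g l - 1))) =
        ∑ l ∈ s, ((a : ℝ) - finrank ℂ ↥((W ⊓ LinearMap.ker (g k - 1)) ⊓ LinearMap.ker (g l - 1))) +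
        ∑ l ∈ s, ((b : ℝ) - finrank ℂ ↥((W ⊓ LinearMap.ker (g k - z • (1 : End ℂ V))) ⊓
          LinearMap.ker (g l - 1))) +
        ∑ l ∈ s, ((b : ℝ) - finrank ℂ ↥((W ⊓ LinearMap.ker (g k - z ^ 2 • (1 : End ℂ V))) ⊓
          LinearMap.ker (g l - 1))) := by
      rw [← Finset.sum_add_distrib, ← Finset.sum_add_distrib]
      refine Finset.sum_congr rfl fun l hl => ?_
      rw [dl l hl, d0, inf_right_comm W (LinearMap.ker (g l - 1)),
        inf_right_comm W (LinearMap.ker (g l - 1)), inf_right_comm W (LinearMap.ker (g l - 1))]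
      push_cast
      ring
    rw [Finset.sum_insert hk, hs, ← ha, d0]
    have hl := aux_log3 a b
    have : ((a + b + b : ℕ) : ℝ) - a = 2 * b := by push_cast; ring
    linarith

theorem aux_two {α : Type*} [DecidableEq α] {i j i' j' : α} (h : i ≠ j) (h' : i' ≠ j') :
    ∃ π : Equiv.Perm α, π i = i' ∧ π j = j' := by
  refine ⟨Equiv.swap (Equiv.swap i i' j) j' * Equiv.swap i i', ?_, ?_⟩
  · rw [Equiv.Perm.mul_apply, Equiv.swap_apply_left]
    apply Equiv.swap_apply_of_ne_of_ne _ h'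
    intro e
    apply h
    apply (Equiv.swap i i').injective
    rw [Equiv.swap_apply_left, ← e]
  · rw [Equiv.Perm.mul_apply, Equiv.swap_apply_left]

theorem aux_perm3 : ∃ c u : Equiv.Perm (Fin 3), c ^ 3 = 1 ∧ u * u = 1 ∧ u * c = c ^ 2 * u ∧
    c 0 = 1 := ⟨finRotate 3, Equiv.swap 0 1, by decide, by decide, by decide, by decide⟩

theorem aux_perm (M : ℕ) : ∃ (c u : Fin (M / 3) → Equiv.Perm (Fin M)) (p q : Fin (M / 3) → Fin M),
    (∀ k, c k ^ 3 = 1) ∧ (∀ k, u k * u k = 1) ∧ (∀ k, u k * c k = c k ^ 2 * u k) ∧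
    (∀ k l, k ≠ l → Commute (c k) (c l)) ∧ (∀ k l, k ≠ l → Commute (c k) (u l)) ∧
    (∀ k, p k ≠ q k) ∧ (∀ k, c k (p k) = q k) := by
  obtain ⟨c, u, hc3, hu2, huc, hc0⟩ := aux_perm3
  obtain ⟨e⟩ : Nonempty ((Σ _ : Fin (M / 3), Fin 3) ↪ Fin M) :=
    ⟨⟨fun p => ⟨3 * p.1 + p.2, by have := p.1.2; have := p.2.2; omega⟩, by
      rintro ⟨a, b⟩ ⟨c, d⟩ h
      have h : 3 * (a : ℕ) + b = 3 * c + d := congrArg Fin.val h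
      have := b.2
      have := d.2
      obtain rfl : a = c := Fin.ext (by omega)
      obtain rfl : b = d := Fin.ext (by omega)
      rfl⟩⟩
  obtain ⟨φ, hφ⟩ : ∃ φ : (Fin (M / 3) → Equiv.Perm (Fin 3)) →* Equiv.Perm (Fin M),
      ∀ f k x, φ f (e ⟨k, x⟩) = e ⟨k, f k x⟩ :=
    ⟨(Equiv.Perm.viaEmbeddingHom e).comp
      (Equiv.Perm.sigmaCongrRightHom (fun _ : Fin (M / 3) => Fin 3)), fun f k x => by
      rw [MonoidHom.comp_apply, Equiv.Perm.viaEmbeddingHom_apply, Equiv.Perm.viaEmbedding_apply]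
      rfl⟩
  refine ⟨fun k => φ (Pi.mulSingle k c), fun k => φ (Pi.mulSingle k u), fun k => e ⟨k, 0⟩,
    fun k => e ⟨k, 1⟩, fun k => ?_, fun k => ?_, fun k => ?_, fun k l h => ?_, fun k l h => ?_,
    fun k => ?_, fun k => ?_⟩
  · rw [← map_pow, ← Pi.mulSingle_pow, hc3, Pi.mulSingle_one, map_one]
  · rw [← map_mul, ← Pi.mulSingle_mul, hu2, Pi.mulSingle_one, map_one]
  · rw [← map_pow, ← map_mul, ← map_mul, ← Pi.mulSingle_pow,
        ← Pi.mulSingle_mul, ← Pi.mulSingle_mul, huc]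
  · exact (Pi.mulSingle_commute h c c).map φ
  · exact (Pi.mulSingle_commute h c u).map φ
  · intro h
    have := e.injective h
    simp at this
  · rw [hφ, Pi.mulSingle_eq_same, hc0]

open Module in
theorem aux_rep (M n : ℕ) (hM : 3 ≤ M) (V : Type*) [AddCommGroup V] [Module ℂ V]
    [FiniteDimensional ℂ V] (hV : finrank ℂ V = 2 ^ n)
    (R : Equiv.Perm (Fin M) →* End ℂ V) (X : Fin M → Submodule ℂ V)
    (hX : ∀ π i, (X i).map (R π) = X (π i)) (i j : Fin M) (hij : i ≠ j) :
    ((M / 3 : ℕ) : ℝ) * ((finrank ℂ (X i) : ℝ) - finrank ℂ ↥(X i ⊓ X j)) ≤ 2 ^ n * n := by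
  obtain ⟨z, hz⟩ : ∃ z : ℂ, z ^ 2 + z + 1 = 0 := by
    have h := Complex.isPrimitiveRoot_exp 3 (by norm_num)
    set z := Complex.exp (2 * Real.pi * Complex.I / (3 : ℕ))
    refine ⟨z, ?_⟩
    have h1 : z ^ 3 = 1 := h.pow_eq_one
    have h2 : z - 1 ≠ 0 := sub_ne_zero.2 (h.ne_one (by norm_num))
    apply (mul_eq_zero.1 (show (z - 1) * (z ^ 2 + z + 1) = 0 by linear_combination h1)).resolve_left h2
  have hinj : ∀ π, Function.Injective (R π) := by
    intro π a b hab
    have e : ∀ v, R π⁻¹ (R π v) = v := fun v => by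
      rw [← Module.End.mul_apply, ← map_mul]; simp
    rw [← e a, hab, e]
  obtain ⟨c, u, p, q, r1, r2, r3, r4, r5, hpq, hcp⟩ := aux_perm M
  have main := aux_main z hz (fun k => R (c k)) (fun k => R (u k))
    (fun k => by rw [← map_pow, r1, map_one])
    (fun k => by rw [← map_mul, r2, map_one])
    (fun k => by rw [← map_pow, ← map_mul, ← map_mul, r3])
    (fun k l h => (r4 k l h).map R)
    (fun k l h => (r5 k l h).map R) Finset.univ ⊤
    (fun _ _ _ _ => Submodule.mem_top) (fun _ _ _ _ => Submodule.mem_top)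
  have hterm : ∀ k : Fin (M / 3), ((finrank ℂ (X i) : ℝ) - finrank ℂ ↥(X i ⊓ X j)) ≤
      (finrank ℂ (⊤ : Submodule ℂ V) : ℝ) - finrank ℂ ↥(⊤ ⊓ LinearMap.ker (R (c k) - 1)) := by
    intro k
    obtain ⟨π, h1, h2⟩ := aux_two hij (hpq k)
    have hfr : ∀ W : Submodule ℂ V, finrank ℂ (W.map (R π)) = finrank ℂ W := fun W =>
      (Submodule.equivMapOfInjective (R π) (hinj π) W).finrank_eq.symm
    have d1 : finrank ℂ (X i) = finrank ℂ (X (p k)) := by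
      rw [← h1, ← hX, hfr]
    have d2 : finrank ℂ ↥(X i ⊓ X j) = finrank ℂ ↥(X (p k) ⊓ X (q k)) := by
      rw [← h1, ← h2, ← hX, ← hX, ← Submodule.map_inf _ (hinj π), hfr]
    have hle : X (p k) ⊓ LinearMap.ker (R (c k) - 1) ≤ X (p k) ⊓ X (q k) := by
      rintro v ⟨hv, hv'⟩
      refine ⟨hv, ?_⟩
      have e1 : (R (c k)) v = v := by simpa [sub_eq_zero] using hv'
      have : R (c k) v ∈ X (q k) := by
        rw [← hcp, ← hX]
        exact Submodule.mem_map_of_mem hv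
      have e2 : R (c k) v = v := e1
      rwa [e2] at this
    have q1 := Submodule.finrank_mono hle
    have q2 := Submodule.finrank_sup_add_finrank_inf_eq (X (p k)) (LinearMap.ker (R (c k) - 1))
    have q3 := Submodule.finrank_le (X (p k) ⊔ LinearMap.ker (R (c k) - 1))
    rw [top_inf_eq, finrank_top, d1, d2]
    have : finrank ℂ (X (p k)) + finrank ℂ (LinearMap.ker (R (c k) - 1)) ≤
      finrank ℂ V + finrank ℂ ↥(X (p k) ⊓ X (q k)) := by omega
    have : (finrank ℂ (X (p k)) : ℝ) + finrank ℂ (LinearMap.ker (R (c k) - 1)) ≤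
      finrank ℂ V + finrank ℂ ↥(X (p k) ⊓ X (q k)) := by exact_mod_cast this
    linarith
  have hsum := Finset.sum_le_sum (s := Finset.univ) fun k _ => hterm k
  rw [Finset.sum_const, Finset.card_univ, Fintype.card_fin, nsmul_eq_mul] at hsum
  refine hsum.trans (main.trans (le_of_eq ?_))
  rw [finrank_top, hV]
  push_cast
  rw [Real.logb_pow, Real.logb_self_eq_one (by norm_num), mul_one]

/-- there is an absolute constant c > 0 (from the bound "every
    irreducible constituent of an N-dimensional representation of S_M has
    first row or column of length > M − c·n", n = log₂ N) such that whenever a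
    unitary representation ρ : S_M → U(N), N = 2^n, permutes a family of M
    subspaces X₁,…,X_M of ℂ^N according to the natural S_M-action
    (ρ(π)(X_i) = X_{π(i)}), then for all i, j:
    dim X_i − dim(X_i ∩ X_j) ≤ (2cn/M)·N. -/
theorem stmt8 :
    ∃ c : ℝ, 0 < c ∧
      ∀ (M n : ℕ)
        (ρ : Equiv.Perm (Fin M) →* Matrix.unitaryGroup (Fin (2 ^ n)) ℂ)
        (X : Fin M → Submodule ℂ (Fin (2 ^ n) → ℂ)),
        (∀ (π : Equiv.Perm (Fin M)) (i : Fin M),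
          (X i).map (Matrix.mulVecLin ((ρ π : Matrix (Fin (2 ^ n)) (Fin (2 ^ n)) ℂ))) = X (π i)) →
        ∀ i j : Fin M,
          (Module.finrank ℂ (X i) : ℝ) - (Module.finrank ℂ ↥(X i ⊓ X j) : ℝ) ≤
            (2 * c * n / M) * (2 ^ n : ℝ) := by
  refine ⟨5 / 2, by norm_num, ?_⟩
  intro M n ρ X hX i j
  have hMpos : 0 < M := lt_of_le_of_lt (Nat.zero_le _) i.2
  have hMr : (0 : ℝ) < M := by exact_mod_cast hMpos
  have hN : (0 : ℝ) < 2 ^ n := by positivity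
  by_cases hij : i = j
  · subst hij
    rw [inf_idem, sub_self]
    positivity
  have hXi : Module.finrank ℂ (X i) ≤ 2 ^ n := by
    simpa using Submodule.finrank_le (X i)
  have hmono : Module.finrank ℂ ↥(X i ⊓ X j) ≤ Module.finrank ℂ (X i) :=
    Submodule.finrank_mono inf_le_left
  let R : Equiv.Perm (Fin M) →* Module.End ℂ (Fin (2 ^ n) → ℂ) :=
    ((Matrix.toLinAlgEquiv' : Matrix (Fin (2 ^ n)) (Fin (2 ^ n)) ℂ ≃ₐ[ℂ] _) :
      Matrix (Fin (2 ^ n)) (Fin (2 ^ n)) ℂ →* Module.End ℂ (Fin (2 ^ n) → ℂ)).comp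
      ((Matrix.unitaryGroup (Fin (2 ^ n)) ℂ).subtype.comp ρ)
  have hR : ∀ π i, (X i).map (R π) = X (π i) := fun π i => hX π i
  rcases Nat.lt_or_ge M 3 with hM | hM
  · rcases Nat.eq_zero_or_pos n with rfl | hn
    · have hfr : Module.finrank ℂ (X j) = Module.finrank ℂ (X i) := by
        have hle : ∀ a b : Fin M, Module.finrank ℂ (X b) ≤ Module.finrank ℂ (X a) := fun a b => by
          have := hR (Equiv.swap a b) a
          rw [Equiv.swap_apply_left] at this
          rw [← this]
          exact Submodule.finrank_map_le _ _
        exact le_antisymm (hle _ _) (hle _ _)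
      have : Module.finrank ℂ ↥(X i ⊓ X j) = Module.finrank ℂ (X i) := by
        rcases Nat.eq_zero_or_pos (Module.finrank ℂ (X i)) with h | h
        · omega
        · have h1 : Module.finrank ℂ (X i) = 1 := le_antisymm (hXi.trans (le_of_eq (pow_zero 2))) h
          have t1 : X i = ⊤ := Submodule.eq_top_of_finrank_eq (by rw [h1, Module.finrank_fin_fun, pow_zero])
          have t2 : X j = ⊤ := Submodule.eq_top_of_finrank_eq (by rw [hfr, h1, Module.finrank_fin_fun, pow_zero])
          rw [t1, t2, inf_idem]
      rw [this]; simp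
    · have h1 : (Module.finrank ℂ (X i) : ℝ) ≤ 2 ^ n := by exact_mod_cast hXi
      have h2 : (0 : ℝ) ≤ Module.finrank ℂ ↥(X i ⊓ X j) := by positivity
      have h3 : (1 : ℝ) ≤ 2 * (5 / 2) * n / M := by
        rw [le_div_iff₀ hMr]
        have : (1 : ℝ) ≤ n := by exact_mod_cast hn
        have : (M : ℝ) < 3 := by exact_mod_cast hM
        linarith
      nlinarith
  · have h := aux_rep M n hM (Fin (2 ^ n) → ℂ) (by simp) R X hR i j hij
    have hd : (0 : ℝ) ≤ (Module.finrank ℂ (X i) : ℝ) - Module.finrank ℂ ↥(X i ⊓ X j) := by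
      rw [sub_nonneg]; exact_mod_cast hmono
    have hM5 : (M : ℝ) ≤ 5 * ((M / 3 : ℕ) : ℝ) := by
      have : M ≤ 5 * (M / 3) := by omega
      exact_mod_cast this
    rw [div_mul_eq_mul_div, le_div_iff₀ hMr]
    nlinarith [mul_le_mul_of_nonneg_left hM5 hd]
end

section
/- Suppose computations on m qubits can be obliviously simulated in an n-qubit, k-clean-qubit quantum computer, where the M = 2^m inputs are encoded by subspaces 𝒳 of ℂ^{2^n} of dimension 2^{n−k} each, permutable in all M! ways by unitaries, and with the maps f_π forming a genuine representation of S_M. If moreover dim(X∩Y)/dim(X) ≤ 1 − 1/poly(m) for all distinct X, Y ∈ 𝒳, then 1 − 2^{k+1}cn/M ≤ 1 − 1/poly(m), hence m ≤ (k + log n)(1+o(1)). -/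
open Filter

section helpers
variable {V : Type*} [AddCommGroup V] [Module ℂ V] [FiniteDimensional ℂ V]

lemma aux_omega : ∃ w : ℂ, 1 + w + w ^ 2 = 0 ∧ w ^ 3 = 1 := by
  obtain ⟨w, hw⟩ := IsAlgClosed.exists_eval₂_eq_zero (RingHom.id ℂ)
    (Polynomial.X ^ 2 + Polynomial.X + 1 : Polynomial ℂ) (by
      have : (Polynomial.X ^ 2 + Polynomial.X + 1 : Polynomial ℂ).degree = 2 := by compute_degree!
      rw [this]; norm_num)
  simp at hw
  refine ⟨w, by linear_combination hw, by linear_combination (w - 1) * hw⟩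

/-- eigenspace inside U -/
def eg (T : Module.End ℂ V) (z : ℂ) (U : Submodule ℂ V) : Submodule ℂ V :=
  U ⊓ LinearMap.ker (T - z • 1)

lemma mem_eg {T : Module.End ℂ V} {z : ℂ} {U : Submodule ℂ V} {v : V} :
    v ∈ eg T z U ↔ v ∈ U ∧ T v = z • v := by
  simp [eg, sub_eq_zero]

lemma eg_split (T : Module.End ℂ V) (hT : T ^ 3 = 1) (w : ℂ) (hw : 1 + w + w ^ 2 = 0)
    (hw3 : w ^ 3 = 1) (U : Submodule ℂ V) (hU : ∀ v ∈ U, T v ∈ U) :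
    Module.finrank ℂ U = Module.finrank ℂ (eg T 1 U) + Module.finrank ℂ (eg T w U)
      + Module.finrank ℂ (eg T (w ^ 2) U) := by
  have hT3 : ∀ v, T (T (T v)) = v := fun v => by
    have := congrArg (fun f : Module.End ℂ V => f v) hT
    simpa [pow_succ] using this
  have hw1 : w ^ 2 - w ≠ 0 := by
    intro h
    have h1 : w = w ^ 2 := by linear_combination -h
    have h2 : w ^ 2 = 1 := by
      have : w ^ 3 = w * w ^ 2 := by ring
      rw [← h1] at this; rw [← hw3, this]; ring
    rw [h2] at h1
    rw [h1] at hw; norm_num at hw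
  have h12 : eg T w U ⊓ eg T (w ^ 2) U = ⊥ := by
    rw [eq_bot_iff]
    rintro v ⟨h1, h2⟩
    have h1 := (mem_eg.1 h1).2
    have h2 := (mem_eg.1 h2).2
    rw [h1, ← sub_eq_zero, ← sub_smul] at h2
    rcases smul_eq_zero.1 h2 with h | h
    · exact absurd (by linear_combination -h) hw1
    · simpa using h
  have h0 : eg T 1 U ⊓ (eg T w U ⊔ eg T (w ^ 2) U) = ⊥ := by
    rw [eq_bot_iff]
    rintro v ⟨h1, h2⟩
    obtain ⟨x, hx, y, hy, rfl⟩ := Submodule.mem_sup.1 h2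
    have h1 := (mem_eg.1 h1).2
    have hx := (mem_eg.1 hx).2
    have hy := (mem_eg.1 hy).2
    rw [one_smul] at h1
    have e : (x + y) + T (x + y) + T (T (x + y)) = (3 : ℂ) • (x + y) := by
      rw [h1, h1]; module
    have e2 : (x + y) + T (x + y) + T (T (x + y)) =
        (1 + w + w ^ 2) • x + (1 + w + w ^ 2 + w * (w ^ 3 - 1)) • y := by
      simp only [map_add, hx, hy, map_smul]; module
    rw [e2, hw, hw3] at e
    rw [zero_smul, sub_self, mul_zero, add_zero, zero_smul, add_zero] at e
    rcases smul_eq_zero.1 e.symm with h | h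
    · norm_num at h
    · exact (Submodule.mem_bot ℂ).2 h
  have hs : eg T 1 U ⊔ (eg T w U ⊔ eg T (w ^ 2) U) = U := by
    apply le_antisymm
    · refine sup_le inf_le_left (sup_le inf_le_left inf_le_left)
    · intro v hv
      have m1 := hU _ hv
      have m2 := hU _ m1
      have key : v = (1/3 : ℂ) • (v + T v + T (T v)) +
        ((1/3 : ℂ) • (v + w ^ 2 • T v + w • T (T v)) +
          (1/3 : ℂ) • (v + w • T v + w ^ 2 • T (T v))) := by
        have : (1/3 : ℂ) • (v + T v + T (T v)) +
        ((1/3 : ℂ) • (v + w ^ 2 • T v + w • T (T v)) +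
          (1/3 : ℂ) • (v + w • T v + w ^ 2 • T (T v))) = v + ((1/3 : ℂ) * (1 + w + w^2)) • (T v)
           + ((1/3 : ℂ) * (1 + w + w^2)) • (T (T v)) := by module
        rw [this, hw]; simp
      rw [key]
      refine Submodule.add_mem_sup (mem_eg.2 ⟨?_, ?_⟩)
        (Submodule.add_mem_sup (mem_eg.2 ⟨?_, ?_⟩) (mem_eg.2 ⟨?_, ?_⟩))
      · exact U.smul_mem _ (U.add_mem (U.add_mem hv m1) m2)
      · simp only [map_smul, map_add, hT3]; module
      · exact U.smul_mem _ (U.add_mem (U.add_mem hv (U.smul_mem _ m1)) (U.smul_mem _ m2))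
      · simp only [map_smul, map_add, hT3, smul_smul, smul_add]
        have a : w * (1 / 3 * w ^ 2) = 1/3 := by linear_combination (1/3) * hw3
        rw [a]; module
      · exact U.smul_mem _ (U.add_mem (U.add_mem hv (U.smul_mem _ m1)) (U.smul_mem _ m2))
      · simp only [map_smul, map_add, hT3, smul_smul, smul_add]
        have a : w ^ 2 * (1 / 3 * w) = 1/3 := by linear_combination (1/3) * hw3
        have b : w ^ 2 * (1 / 3 * w ^ 2) = 1/3 * w := by linear_combination (w/3) * hw3
        rw [a, b]; module
  have f1 := Submodule.finrank_sup_add_finrank_inf_eq (eg T 1 U) (eg T w U ⊔ eg T (w ^ 2) U)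
  have f2 := Submodule.finrank_sup_add_finrank_inf_eq (eg T w U) (eg T (w ^ 2) U)
  rw [hs, h0] at f1
  rw [h12] at f2
  simp only [finrank_bot] at f1 f2
  omega

lemma finrank_map_inj (S : Module.End ℂ V) (hS : Function.Injective S) (A : Submodule ℂ V) :
    Module.finrank ℂ (A.map S) = Module.finrank ℂ A :=
  (Submodule.equivMapOfInjective S hS A).finrank_eq.symm

lemma eg_le (S : Module.End ℂ V) (hS : Function.Injective S) (A B : Submodule ℂ V)
    (h : ∀ v ∈ A, S v ∈ B) : Module.finrank ℂ A ≤ Module.finrank ℂ B := by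
  rw [← finrank_map_inj S hS A]
  exact Submodule.finrank_mono (Submodule.map_le_iff_le_comap.2 h)

/-- x log x -/
lemma ent (a b : ℕ) : (a : ℝ) * Real.logb 2 a + 2 * (b * Real.logb 2 b) + 2 * b ≤
    ((a + b + b : ℕ) : ℝ) * Real.logb 2 ((a + b + b : ℕ) : ℝ) := by
  have h1 : (a : ℝ) * Real.logb 2 a ≤ a * Real.logb 2 ((a + b + b : ℕ) : ℝ) := by
    rcases Nat.eq_zero_or_pos a with h | h
    · simp [h]
    · refine mul_le_mul_of_nonneg_left ?_ (by positivity)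
      apply Real.logb_le_logb_of_le (by norm_num) (by positivity)
      exact_mod_cast (by omega)
  have h2 : (b : ℝ) * Real.logb 2 b + b ≤ b * Real.logb 2 ((a + b + b : ℕ) : ℝ) := by
    rcases Nat.eq_zero_or_pos b with h | h
    · simp [h]
    · have : Real.logb 2 (2 * b) = 1 + Real.logb 2 b := by
        rw [Real.logb_mul (by norm_num) (by positivity)]; simp
      have h3 : Real.logb 2 (2 * b) ≤ Real.logb 2 ((a + b + b : ℕ) : ℝ) := by
        apply Real.logb_le_logb_of_le (by norm_num) (by positivity)
        exact_mod_cast (by omega)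
      have hb : (0:ℝ) ≤ b := by positivity
      nlinarith
  push_cast at *
  linarith

lemma main_ind {ι : Type*} [DecidableEq ι] (T S : ι → Module.End ℂ V)
    (hT : ∀ a, T a ^ 3 = 1) (hS : ∀ a, Function.Injective (S a))
    (hTS : ∀ a, T a * S a = S a * T a ^ 2)
    (hTT : ∀ a b, a ≠ b → T a * T b = T b * T a)
    (hST : ∀ a b, a ≠ b → T a * S b = S b * T a) (s : Finset ι) :
    ∀ W : Submodule ℂ V, (∀ a ∈ s, ∀ v ∈ W, T a v ∈ W) → (∀ a ∈ s, ∀ v ∈ W, S a v ∈ W) →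
    ∑ a ∈ s, ((Module.finrank ℂ W : ℝ) - Module.finrank ℂ (eg (T a) 1 W)) ≤
      Module.finrank ℂ W * Real.logb 2 (Module.finrank ℂ W) := by
  obtain ⟨w, hw, hw3⟩ := aux_omega
  induction s using Finset.induction_on with
  | empty =>
    intro W _ _
    simp only [Finset.sum_empty]
    rcases Nat.eq_zero_or_pos (Module.finrank ℂ W) with h | h
    · simp [h]
    · exact mul_nonneg (by positivity) (Real.logb_nonneg (by norm_num) (by exact_mod_cast h))
  | insert b s hb ih =>
    intro W hWT hWS
    have e := eg_split (T b) (hT b) w hw hw3 W (hWT b (by simp))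
    have hTSv : ∀ v, T b (S b v) = S b (T b (T b v)) := fun v => by
      have := congrArg (fun f : Module.End ℂ V => f v) (hTS b)
      simpa [pow_two] using this
    have d12 : Module.finrank ℂ (eg (T b) w W) = Module.finrank ℂ (eg (T b) (w ^ 2) W) := by
      apply le_antisymm
      · refine eg_le (S b) (hS b) _ _ fun v hv => ?_
        obtain ⟨h1, h2⟩ := mem_eg.1 hv
        refine mem_eg.2 ⟨hWS b (by simp) v h1, ?_⟩
        rw [hTSv, h2, map_smul, h2, smul_smul, map_smul, pow_two]
      · refine eg_le (S b) (hS b) _ _ fun v hv => ?_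
        obtain ⟨h1, h2⟩ := mem_eg.1 hv
        refine mem_eg.2 ⟨hWS b (by simp) v h1, ?_⟩
        rw [hTSv, h2, map_smul, h2, smul_smul, map_smul]
        congr 1
        linear_combination w * hw3
    have hne : ∀ a ∈ s, a ≠ b := fun a ha h => hb (h ▸ ha)
    have inv : ∀ z, ∑ a ∈ s, ((Module.finrank ℂ (eg (T b) z W) : ℝ) -
        Module.finrank ℂ (eg (T a) 1 (eg (T b) z W))) ≤
      Module.finrank ℂ (eg (T b) z W) * Real.logb 2 (Module.finrank ℂ (eg (T b) z W)) := by
      intro z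
      refine ih _ (fun a ha v hv => ?_) (fun a ha v hv => ?_)
      · obtain ⟨h1, h2⟩ := mem_eg.1 hv
        refine mem_eg.2 ⟨hWT a (by simp [ha]) v h1, ?_⟩
        have := congrArg (fun f : Module.End ℂ V => f v) (hTT b a (hne a ha).symm)
        simp only [Module.End.mul_apply] at this
        rw [this, h2, map_smul]
      · obtain ⟨h1, h2⟩ := mem_eg.1 hv
        refine mem_eg.2 ⟨hWS a (by simp [ha]) v h1, ?_⟩
        have := congrArg (fun f : Module.End ℂ V => f v) (hST b a (hne a ha).symm)
        simp only [Module.End.mul_apply] at this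
        rw [this, h2, map_smul]
    have comm : ∀ (a : ι) (z : ℂ), eg (T b) z (eg (T a) 1 W) = eg (T a) 1 (eg (T b) z W) :=
      fun a z => inf_right_comm _ _ _
    have e2 : ∀ a ∈ s, Module.finrank ℂ (eg (T a) 1 W) =
        Module.finrank ℂ (eg (T a) 1 (eg (T b) 1 W)) + Module.finrank ℂ (eg (T a) 1 (eg (T b) w W))
        + Module.finrank ℂ (eg (T a) 1 (eg (T b) (w ^ 2) W)) := by
      intro a ha
      rw [← comm, ← comm, ← comm]
      refine eg_split (T b) (hT b) w hw hw3 _ fun v hv => ?_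
      obtain ⟨h1, h2⟩ := mem_eg.1 hv
      refine mem_eg.2 ⟨hWT b (by simp) v h1, ?_⟩
      have := congrArg (fun f : Module.End ℂ V => f v) (hTT a b (hne a ha))
      simp only [Module.End.mul_apply] at this
      rw [this, h2, map_smul]
    rw [Finset.sum_insert hb]
    have key : ∑ a ∈ s, ((Module.finrank ℂ W : ℝ) - Module.finrank ℂ (eg (T a) 1 W)) =
      ∑ a ∈ s, ((Module.finrank ℂ (eg (T b) 1 W) : ℝ) -
        Module.finrank ℂ (eg (T a) 1 (eg (T b) 1 W))) +
      ∑ a ∈ s, ((Module.finrank ℂ (eg (T b) w W) : ℝ) -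
        Module.finrank ℂ (eg (T a) 1 (eg (T b) w W))) +
      ∑ a ∈ s, ((Module.finrank ℂ (eg (T b) (w ^ 2) W) : ℝ) -
        Module.finrank ℂ (eg (T a) 1 (eg (T b) (w ^ 2) W))) := by
      rw [← Finset.sum_add_distrib, ← Finset.sum_add_distrib]
      refine Finset.sum_congr rfl fun a ha => ?_
      rw [e2 a ha, e]; push_cast; ring
    rw [key]
    have i0 := inv 1
    have i1 := inv w
    have i2 := inv (w ^ 2)
    have en := ent (Module.finrank ℂ (eg (T b) 1 W)) (Module.finrank ℂ (eg (T b) w W))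
    rw [← d12] at e i2
    rw [← e] at en
    have e' : (Module.finrank ℂ W : ℝ) = Module.finrank ℂ (eg (T b) 1 W) +
      Module.finrank ℂ (eg (T b) w W) + Module.finrank ℂ (eg (T b) w W) := by exact_mod_cast e
    rw [← d12]
    linarith

lemma two_trans {α : Type*} [DecidableEq α] (x y i j : α) (hxy : x ≠ y) (hij : i ≠ j) :
    ∃ h : Equiv.Perm α, h x = i ∧ h y = j := by
  refine ⟨Equiv.swap (Equiv.swap x i y) j * Equiv.swap x i, ?_, by simp⟩
  have : i ≠ Equiv.swap x i y := by
    intro h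
    have := congrArg (Equiv.swap x i) h
    simp at this; exact hxy this
  simp [Equiv.swap_apply_of_ne_of_ne this hij]

lemma rep_bound (r M : ℕ) (hr : r * 3 ≤ M)
    (R : Equiv.Perm (Fin M) →* Module.End ℂ V) (X : Fin M → Submodule ℂ V)
    (hX : ∀ π i, (X i).map (R π) = X (π i)) (i j : Fin M) (hij : i ≠ j) :
    (r : ℝ) * ((Module.finrank ℂ (X i) : ℝ) - Module.finrank ℂ ↥(X i ⊓ X j)) ≤
      Module.finrank ℂ V * Real.logb 2 (Module.finrank ℂ V) := by
  classical
  have hinj : ∀ π, Function.Injective (R π) := fun π => by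
    apply Function.LeftInverse.injective (g := R π⁻¹)
    intro v
    rw [← Module.End.mul_apply, ← map_mul]; simp
  obtain ⟨e⟩ : Nonempty ((Σ _ : Fin r, Fin 3) ↪ Fin M) := by
    apply Function.Embedding.nonempty_of_card_le; simpa using hr
  let Φ : (Fin r → Equiv.Perm (Fin 3)) →* Equiv.Perm (Fin M) :=
    (Equiv.Perm.viaEmbeddingHom e).comp (Equiv.Perm.sigmaCongrRightHom fun _ : Fin r => Fin 3)
  let Ψ := R.comp Φ
  let c3 : Equiv.Perm (Fin 3) := finRotate 3
  let s3 : Equiv.Perm (Fin 3) := Equiv.swap 1 2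
  let T : Fin r → Module.End ℂ V := fun a => Ψ (Pi.mulSingle a c3)
  let S : Fin r → Module.End ℂ V := fun a => Ψ (Pi.mulSingle a s3)
  have hc : c3 ^ 3 = 1 := by decide
  have hcs : c3 * s3 = s3 * c3 ^ 2 := by decide
  have main := main_ind T S (fun a => by
      simp only [T]; rw [← map_pow, ← Pi.mulSingle_pow, hc]; simp)
    (fun a => hinj _)
    (fun a => by
      simp only [T, S]
      rw [← map_pow, ← map_mul, ← map_mul, ← Pi.mulSingle_pow, ← Pi.mulSingle_mul, hcs,
        Pi.mulSingle_mul])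
    (fun a b hab => by
      simp only [T]
      rw [← map_mul, ← map_mul, (Pi.mulSingle_commute (f := fun _ : Fin r => Equiv.Perm (Fin 3)) hab c3 c3).eq])
    (fun a b hab => by
      simp only [T, S]
      rw [← map_mul, ← map_mul, (Pi.mulSingle_commute (f := fun _ : Fin r => Equiv.Perm (Fin 3)) hab c3 s3).eq])
    Finset.univ ⊤ (by simp) (by simp)
  have hΦ : ∀ a, Φ (Pi.mulSingle a c3) (e ⟨a, 0⟩) = e ⟨a, 1⟩ := by
    intro a
    have : Equiv.Perm.viaEmbedding
      (Equiv.Perm.sigmaCongrRightHom (fun _ : Fin r => Fin 3) (Pi.mulSingle a c3)) e (e ⟨a, 0⟩)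
        = e ⟨a, 1⟩ := by
      rw [Equiv.Perm.viaEmbedding_apply]
      simp [Equiv.Perm.sigmaCongrRightHom, c3]
    exact this
  have each : ∀ a, (Module.finrank ℂ (X i) : ℝ) - Module.finrank ℂ ↥(X i ⊓ X j) ≤
      (Module.finrank ℂ (⊤ : Submodule ℂ V) : ℝ) - Module.finrank ℂ (eg (T a) 1 ⊤) := by
    intro a
    have hne : e ⟨a, 0⟩ ≠ e ⟨a, 1⟩ := by
      intro h; have := e.injective h; simp at this
    obtain ⟨h, h1, h2⟩ := two_trans _ _ i j hne hij
    have q1 : Module.finrank ℂ (X i) = Module.finrank ℂ (X (e ⟨a, 0⟩)) := by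
      rw [← h1, ← hX, finrank_map_inj _ (hinj h)]
    have q2 : Module.finrank ℂ ↥(X i ⊓ X j) =
        Module.finrank ℂ ↥(X (e ⟨a, 0⟩) ⊓ X (e ⟨a, 1⟩)) := by
      rw [← h1, ← h2, ← hX, ← hX, ← Submodule.map_inf _ (hinj h),
        finrank_map_inj _ (hinj h)]
    rw [q1, q2]
    have le : X (e ⟨a, 0⟩) ⊓ eg (T a) 1 ⊤ ≤ X (e ⟨a, 0⟩) ⊓ X (e ⟨a, 1⟩) := by
      rintro v ⟨hv1, hv2⟩
      refine ⟨hv1, ?_⟩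
      have := (mem_eg.1 hv2).2
      rw [one_smul] at this
      have q := hX (Φ (Pi.mulSingle a c3)) (e ⟨a, 0⟩)
      rw [hΦ] at q
      rw [← q]
      exact ⟨v, hv1, this⟩
    have f1 := Submodule.finrank_mono le
    have f2 := Submodule.finrank_sup_add_finrank_inf_eq (X (e ⟨a, 0⟩)) (eg (T a) 1 ⊤)
    have f3 := Submodule.finrank_mono (le_top : X (e ⟨a, 0⟩) ⊔ eg (T a) 1 ⊤ ≤ ⊤)
    have : Module.finrank ℂ (X (e ⟨a, 0⟩)) + Module.finrank ℂ (eg (T a) 1 ⊤) ≤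
      Module.finrank ℂ (⊤ : Submodule ℂ V) +
        Module.finrank ℂ ↥(X (e ⟨a, 0⟩) ⊓ X (e ⟨a, 1⟩)) := by omega
    have : (Module.finrank ℂ (X (e ⟨a, 0⟩)) : ℝ) + Module.finrank ℂ (eg (T a) 1 ⊤) ≤
      Module.finrank ℂ (⊤ : Submodule ℂ V) +
        Module.finrank ℂ ↥(X (e ⟨a, 0⟩) ⊓ X (e ⟨a, 1⟩)) := by exact_mod_cast this
    linarith
  have := Finset.sum_le_sum (s := Finset.univ) fun a _ => each a
  rw [Finset.sum_const, Finset.card_univ, Fintype.card_fin, nsmul_eq_mul] at this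
  rw [finrank_top] at main
  rw [finrank_top] at this
  linarith

end helpers

lemma first_part (m n k : ℕ) (ρ : Equiv.Perm (Fin (2 ^ m)) →* Matrix.unitaryGroup (Fin (2 ^ n)) ℂ)
    (X : Fin (2 ^ m) → Submodule ℂ (Fin (2 ^ n) → ℂ)) (hk : k ≤ n)
    (hX : ∀ (π : Equiv.Perm (Fin (2 ^ m))) (i : Fin (2 ^ m)),
          (X i).map (Matrix.mulVecLin
            ((ρ π : Matrix (Fin (2 ^ n)) (Fin (2 ^ n)) ℂ))) = X (π i))
    (hd : ∀ i, Module.finrank ℂ (X i) = 2 ^ (n - k)) (i j : Fin (2 ^ m)) :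
    1 - (2 : ℝ) ^ (k + 1) * 2 * (n : ℝ) / (2 ^ m : ℝ) ≤
            (Module.finrank ℂ ↥(X i ⊓ X j) : ℝ) / (Module.finrank ℂ (X i) : ℝ) := by
  have hpos : (0 : ℝ) < Module.finrank ℂ (X i) := by rw [hd]; positivity
  have hnn : (0 : ℝ) ≤ (2 : ℝ) ^ (k + 1) * 2 * (n : ℝ) / (2 ^ m : ℝ) := by positivity
  by_cases hij : i = j
  · subst hij
    rw [inf_idem, div_self hpos.ne']; linarith
  rcases Nat.eq_zero_or_pos n with h0 | hn
  · have ht : ∀ i, X i = ⊤ := by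
      intro i
      apply Submodule.eq_top_of_finrank_eq
      rw [hd]; subst h0; simp
    rw [ht i, ht j, inf_idem, div_self (by rw [← ht i]; exact hpos.ne')]; linarith
  have hm : m ≠ 0 := by
    rintro rfl
    apply hij
    have a := i.2
    have b := j.2
    ext; simp at a b; omega
  by_cases hm1 : m = 1
  · subst hm1
    have : (0:ℝ) ≤ (Module.finrank ℂ ↥(X i ⊓ X j) : ℝ) / (Module.finrank ℂ (X i) : ℝ) := by
      positivity
    have h1 : (1:ℝ) ≤ 2 ^ (k + 1) := one_le_pow₀ (by norm_num)
    have h2 : (1:ℝ) ≤ n := by exact_mod_cast hn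
    have : (1 : ℝ) ≤ (2 : ℝ) ^ (k + 1) * 2 * (n : ℝ) / (2 ^ 1 : ℝ) := by
      rw [le_div_iff₀ (by norm_num)]; nlinarith
    linarith
  obtain ⟨q, rfl⟩ : ∃ q, m = q + 2 := ⟨m - 2, by omega⟩
  let R : Equiv.Perm (Fin (2 ^ (q + 2))) →* Module.End ℂ (Fin (2 ^ n) → ℂ) :=
    ((Matrix.toLinAlgEquiv' : Matrix (Fin (2 ^ n)) (Fin (2 ^ n)) ℂ ≃ₐ[ℂ] _) :
      Matrix (Fin (2 ^ n)) (Fin (2 ^ n)) ℂ →* Module.End ℂ (Fin (2 ^ n) → ℂ)).comp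
      ((Submonoid.subtype (Matrix.unitaryGroup (Fin (2 ^ n)) ℂ)).comp ρ)
  have := rep_bound (2 ^ q) (2 ^ (q + 2)) (by rw [pow_add]; omega) R X hX i j hij
  rw [hd] at this ⊢
  rw [Module.finrank_fin_fun] at this
  push_cast at this ⊢
  rw [Real.logb_pow, Real.logb_self_eq_one (by norm_num), mul_one] at this
  obtain ⟨l, rfl⟩ : ∃ l, n = k + l := ⟨n - k, by omega⟩
  rw [Nat.add_sub_cancel_left] at this ⊢
  rw [le_div_iff₀ (by positivity), sub_mul, sub_le_comm, one_mul, div_mul_eq_mul_div,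
    le_div_iff₀ (by positivity)]
  generalize (Module.finrank ℂ ↥(X i ⊓ X j) : ℝ) = I at this ⊢
  have p1 : (2:ℝ) ^ (k + l) = 2 ^ k * 2 ^ l := pow_add _ _ _
  have p2 : (2:ℝ) ^ (q + 2) = 2 ^ q * 4 := by rw [pow_add]; norm_num
  have p3 : (2:ℝ) ^ (k + 1) = 2 ^ k * 2 := pow_succ _ _
  rw [p1] at this
  rw [p2, p3]
  linarith

lemma asym (m n k : ℕ → ℕ) (C : ℝ) (d : ℕ) (hC : 0 < C) (hk : ∀ t, k t ≤ n t)
    (hk0 : ∀ t, 1 ≤ m t → 1 ≤ k t)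
    (h : ∀ t, 1 ≤ m t → 1 - (2 : ℝ) ^ (k t + 1) * 2 * (n t : ℝ) / (2 ^ m t : ℝ) ≤
      1 - 1 / (C * (m t : ℝ) ^ d)) (hm : Tendsto m atTop atTop) :
    ∃ ε : ℕ → ℝ, Tendsto ε atTop (nhds 0) ∧
          ∀ t, (m t : ℝ) ≤ ((k t : ℝ) + Real.logb 2 (n t)) * (1 + ε t) := by
  have hK0 : ∀ t, 0 ≤ Real.logb 2 (n t) := fun t => by
    rcases Nat.eq_zero_or_pos (n t) with h | h
    · simp [h]
    · exact Real.logb_nonneg (by norm_num) (by exact_mod_cast h)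
  have hK : ∀ t, 1 ≤ m t → 1 ≤ (k t : ℝ) + Real.logb 2 (n t) := fun t ht => by
    have := hK0 t
    have h2 : (1:ℝ) ≤ k t := by exact_mod_cast hk0 t ht
    linarith
  refine ⟨fun t => max 0 ((m t : ℝ) / ((k t : ℝ) + Real.logb 2 (n t)) - 1), ?_, ?_⟩
  · let δ : ℝ → ℝ := fun x => (2 + Real.logb 2 C + d * Real.logb 2 x) / x
    have hδ : Tendsto δ atTop (nhds 0) := by
      have h1 : Tendsto (fun x : ℝ => (2 + Real.logb 2 C) / x) atTop (nhds 0) :=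
        tendsto_const_nhds.div_atTop tendsto_id
      have h2 : Tendsto (fun x : ℝ => Real.log x / x) atTop (nhds 0) :=
        Real.isLittleO_log_id_atTop.tendsto_div_nhds_zero
      have h3 := h1.add (h2.const_mul (d / Real.log 2))
      simp only [mul_zero, add_zero] at h3
      refine h3.congr fun x => ?_
      simp only [δ, Real.logb]; ring
    have hδm : Tendsto (fun t => δ (m t)) atTop (nhds 0) :=
      hδ.comp (tendsto_natCast_atTop_atTop.comp hm)
    have lim : Tendsto (fun t => max 0 (1 / (1 - δ (m t)) - 1)) atTop (nhds 0) := by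
      have := (tendsto_const_nhds (x := (1:ℝ))).sub hδm
      have := ((tendsto_const_nhds (x := (1:ℝ))).div this (by norm_num)).sub
        (tendsto_const_nhds (x := (1:ℝ)))
      have := (tendsto_const_nhds (x := (0:ℝ))).max this
      simpa using this
    refine tendsto_of_tendsto_of_tendsto_of_le_of_le' tendsto_const_nhds lim
      (Eventually.of_forall fun t => le_max_left _ _) ?_
    filter_upwards [hm.eventually_ge_atTop 1, hδm.eventually_lt_const (show (0:ℝ) < 1/2 by norm_num)]
      with t ht hlt
    refine max_le_max le_rfl (sub_le_sub_right ?_ _)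
    have hKt := hK t ht
    rw [div_le_div_iff₀ (by linarith) (by linarith)]
    have hmt : (0:ℝ) < m t := by exact_mod_cast ht
    have hnt : (0:ℝ) < n t := by exact_mod_cast (hk0 t ht).trans (hk t)
    have e := h t ht
    have e1 : 1 / (C * (m t : ℝ) ^ d) ≤ (2 : ℝ) ^ (k t + 1) * 2 * (n t : ℝ) / (2 ^ m t : ℝ) := by
      linarith
    rw [div_le_div_iff₀ (by positivity) (by positivity), one_mul] at e1
    have e2 := Real.logb_le_logb_of_le (b := 2) (by norm_num) (by positivity) e1
    rw [Real.logb_mul (by positivity) (by positivity), Real.logb_mul (by positivity) (by positivity),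
      Real.logb_mul (by positivity) (by positivity), Real.logb_mul (by positivity) (by positivity),
      Real.logb_pow, Real.logb_pow, Real.logb_pow, Real.logb_self_eq_one (by norm_num)] at e2
    push_cast at e2
    have e3 : (m t : ℝ) * δ (m t) = 2 + Real.logb 2 C + d * Real.logb 2 (m t) := by
      simp only [δ]; field_simp
    rw [mul_sub, e3]
    linarith
  · intro t
    rcases Nat.eq_zero_or_pos (m t) with h0 | h1
    · have := hK0 t
      simp only [h0]
      push_cast
      exact mul_nonneg (by positivity) (add_nonneg zero_le_one (le_max_left _ _))
    · have hKt := hK t h1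
      have := le_max_right 0 ((m t : ℝ) / ((k t : ℝ) + Real.logb 2 (n t)) - 1)
      calc (m t : ℝ) = ((k t : ℝ) + Real.logb 2 (n t)) *
            (1 + ((m t : ℝ) / ((k t : ℝ) + Real.logb 2 (n t)) - 1)) := by field_simp; ring
        _ ≤ _ := mul_le_mul_of_nonneg_left (by linarith) (by linarith)

/-- Theorem 2, simple case: there is an absolute constant c > 0
    such that the following holds.  Consider a family (indexed by t) of
    oblivious simulations: M = 2^{m t} inputs encoded as subspaces
    X t i ⊆ ℂ^{2^{n t}} of dimension 2^{n t − k t}, permuted in all M! ways by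
    a genuine unitary representation ρ t of S_M.  If moreover
    dim(X∩Y)/dim X ≤ 1 − 1/poly(m) for all distinct encodings (a polynomial
    lower bound on distinguishability), then — since
    dim X − dim(X∩Y) ≤ (2cn/M)·2^n gives 1 − 2^{k+1}cn/M ≤ 1 − 1/poly(m) —
    we get m ≤ (k + log n)(1 + o(1)). -/
theorem stmt11 :
    ∃ c : ℝ, 0 < c ∧
      ∀ (m n k : ℕ → ℕ)
        (ρ : ∀ t, Equiv.Perm (Fin (2 ^ m t)) →* Matrix.unitaryGroup (Fin (2 ^ n t)) ℂ)
        (X : ∀ t, Fin (2 ^ m t) → Submodule ℂ (Fin (2 ^ n t) → ℂ)),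
        (∀ t, k t ≤ n t) →
        (∀ t (π : Equiv.Perm (Fin (2 ^ m t))) (i : Fin (2 ^ m t)),
          (X t i).map (Matrix.mulVecLin
            ((ρ t π : Matrix (Fin (2 ^ n t)) (Fin (2 ^ n t)) ℂ))) = X t (π i)) →
        (∀ t (i : Fin (2 ^ m t)), Module.finrank ℂ (X t i) = 2 ^ (n t - k t)) →
        (∃ (C : ℝ) (d : ℕ), 0 < C ∧
          ∀ t (i j : Fin (2 ^ m t)), i ≠ j →
            (Module.finrank ℂ ↥(X t i ⊓ X t j) : ℝ) / (Module.finrank ℂ (X t i) : ℝ) ≤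
              1 - 1 / (C * (m t : ℝ) ^ d)) →
        Tendsto m atTop atTop →
        (∀ t (i j : Fin (2 ^ m t)),
          1 - (2 : ℝ) ^ (k t + 1) * c * (n t : ℝ) / (2 ^ m t : ℝ) ≤
            (Module.finrank ℂ ↥(X t i ⊓ X t j) : ℝ) / (Module.finrank ℂ (X t i) : ℝ)) ∧
        ∃ ε : ℕ → ℝ, Tendsto ε atTop (nhds 0) ∧
          ∀ t, (m t : ℝ) ≤ ((k t : ℝ) + Real.logb 2 (n t)) * (1 + ε t) := by
  refine ⟨2, by norm_num, ?_⟩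
  intro m n k ρ X hk hX hd hpoly hm
  obtain ⟨C, d, hC, hp⟩ := hpoly
  have F : ∀ t (i j : Fin (2 ^ m t)),
          1 - (2 : ℝ) ^ (k t + 1) * 2 * (n t : ℝ) / (2 ^ m t : ℝ) ≤
            (Module.finrank ℂ ↥(X t i ⊓ X t j) : ℝ) / (Module.finrank ℂ (X t i) : ℝ) :=
    fun t i j => first_part (m t) (n t) (k t) (ρ t) (X t) (hk t) (hX t) (hd t) i j
  have pair : ∀ t, 1 ≤ m t → ∃ i j : Fin (2 ^ m t), i ≠ j := by
    intro t ht
    have : 1 < 2 ^ m t := Nat.one_lt_two_pow (by omega)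
    exact ⟨⟨0, by omega⟩, ⟨1, this⟩, by simp⟩
  refine ⟨F, asym m n k C d hC hk ?_ ?_ hm⟩
  · intro t ht
    by_contra hcon
    have hk0 : k t = 0 := by omega
    obtain ⟨i, j, hij⟩ := pair t ht
    have hT : ∀ i, X t i = ⊤ := by
      intro i
      apply Submodule.eq_top_of_finrank_eq
      rw [hd, hk0]; simp
    have := hp t i j hij
    have hpos : (0 : ℝ) < Module.finrank ℂ (X t i) := by rw [hd]; positivity
    rw [hT j, inf_top_eq, div_self hpos.ne'] at this
    have hmt : (0:ℝ) < m t := by exact_mod_cast ht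
    have : 0 < 1 / (C * (m t : ℝ) ^ d) := by positivity
    linarith
  · intro t ht
    obtain ⟨i, j, hij⟩ := pair t ht
    exact (F t i j).trans (hp t i j hij)
end
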